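/- arXiv:1809.03028 — 3 statements merged into one kernel-verified Lean document; each statement's English description precedes it below -/
import Mathlib

section
/- For every α, β ∈ ℕ there is a constant C > 0, depending only on α and β, such that the following holds. Let ν ∈ ℂ, let λ be a nonzero real number, and let g : ℝ∖{0} → ℂ be smooth with g(1) = 0. Define f(ξ) = (i/λ)·g(ξ)/(ξ − 1) for ξ ≠ 1, extended smoothly at ξ = 1 by f(1) = (i/λ)·g′(1). Then, with I = [1/2, 3/2], ‖𝒰^β 𝒳^α f‖_{𝕃²(I)} ≤ (C/|λ|) · Σ_{j+k ≤ α+2β+1} ‖𝒰^j 𝒳^k g‖_{𝕃²(ℝ)}, provided the right-hand side is finite. -/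
open Complex Finset MeasureTheory

/-- The operator `𝒳 f (ξ) = -2 ξ f'(ξ)`. -/
noncomputable def calX (f : ℝ → ℂ) : ℝ → ℂ := fun ξ => -2 * (ξ : ℂ) * deriv f ξ

/-- The operator `𝒰 f (ξ) = i((ν²-1)/(4ξ) f(ξ) - ξ f''(ξ))`. -/
noncomputable def calU (ν : ℂ) (f : ℝ → ℂ) : ℝ → ℂ :=
  fun ξ => Complex.I * ((ν ^ 2 - 1) / (4 * (ξ : ℂ)) * f ξ - (ξ : ℂ) * deriv (deriv f) ξ)

/-- The norm of `L²(J, |ξ|⁻¹ dξ)`, valued in `ℝ≥0∞`. -/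
noncomputable def L2w (h : ℝ → ℂ) (J : Set ℝ) : ENNReal :=
  (∫⁻ ξ in J, ENNReal.ofReal (‖h ξ‖ ^ 2) / ENNReal.ofReal |ξ|) ^ (1 / 2 : ℝ)

theorem hasDerivAt_integral_pow_mul_segment {φ : ℝ → ℂ}
    (hφ : ContDiffOn ℝ (⊤ : ℕ∞) φ (Set.Ioi 0)) (m : ℕ) {x : ℝ} (hx : 0 < x) :
    HasDerivAt (fun x : ℝ => ∫ t in (0 : ℝ)..1, (t : ℂ) ^ m * φ (1 + t * (x - 1)))
      (∫ t in (0 : ℝ)..1, (t : ℂ) ^ (m + 1) * deriv φ (1 + t * (x - 1))) x := by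
  have hφ' := ((contDiffOn_infty_iff_deriv_of_isOpen isOpen_Ioi).1 hφ)
  have hpos : ∀ y : ℝ, 0 < y → ∀ t ∈ Set.Icc (0 : ℝ) 1, 1 + t * (y - 1) ∈ Set.Ioi (0 : ℝ) := by
    intro y hy t ht
    rcases ht with ⟨h0, h1⟩
    simp only [Set.mem_Ioi]
    rcases h1.lt_or_eq with h | h
    · nlinarith [mul_nonneg h0 hy.le]
    · subst h; linarith
  have hcont : ∀ (ψ : ℝ → ℂ) (k : ℕ) (y : ℝ), 0 < y → ContinuousOn ψ (Set.Ioi 0) →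
      ContinuousOn (fun t : ℝ => (t : ℂ) ^ k * ψ (1 + t * (y - 1))) (Set.Icc 0 1) := by
    intro ψ k y hy hψ
    exact ContinuousOn.mul (by fun_prop) (hψ.comp (by fun_prop) (hpos y hy))
  have hsub : Set.uIoc (0 : ℝ) 1 ⊆ Set.Icc 0 1 := by
    rw [Set.uIoc_of_le zero_le_one]; exact Set.Ioc_subset_Icc_self
  have hmeas : ∀ (ψ : ℝ → ℂ) (k : ℕ) (y : ℝ), 0 < y → ContinuousOn ψ (Set.Ioi 0) →
      AEStronglyMeasurable (fun t : ℝ => (t : ℂ) ^ k * ψ (1 + t * (y - 1)))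
        (volume.restrict (Set.uIoc 0 1)) := fun ψ k y hy hψ =>
    ((hcont ψ k y hy hψ).mono hsub).aestronglyMeasurable measurableSet_uIoc
  have hK : Set.Icc (min 1 (x / 2)) (max 1 (2 * x)) ⊆ Set.Ioi (0 : ℝ) := fun y hy =>
    lt_of_lt_of_le (lt_min one_pos (by linarith)) hy.1
  obtain ⟨B, hB⟩ := isCompact_Icc.exists_bound_of_continuousOn (hφ'.2.continuousOn.mono hK)
  refine (intervalIntegral.hasDerivAt_integral_of_dominated_loc_of_deriv_le (μ := volume)
    (bound := fun _ => B)
    (F := fun (x t : ℝ) => (t : ℂ) ^ m * φ (1 + t * (x - 1)))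
    (F' := fun (x t : ℝ) => (t : ℂ) ^ (m + 1) * deriv φ (1 + t * (x - 1)))
    (s := Set.Icc (x / 2) (2 * x)) (Icc_mem_nhds (by linarith) (by linarith)) ?_ ?_ ?_ ?_ ?_ ?_).2
  · filter_upwards [lt_mem_nhds hx] with y hy using hmeas φ m y hy hφ.continuousOn
  · refine ContinuousOn.intervalIntegrable ?_
    rw [Set.uIcc_of_le zero_le_one]
    exact hcont φ m x hx hφ.continuousOn
  · exact hmeas _ _ x hx hφ'.2.continuousOn
  · refine Filter.Eventually.of_forall fun t ht y hy => ?_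
    obtain ⟨h0, h1⟩ := hsub ht
    have h2 : ‖deriv φ (1 + t * (y - 1))‖ ≤ B := by
      apply hB
      have e : 1 + t * (y - 1) = (1 - t) * 1 + t * y := by ring
      rw [e]
      constructor
      · nlinarith [min_le_left 1 (x / 2), min_le_right 1 (x / 2), hy.1]
      · nlinarith [le_max_left 1 (2 * x), le_max_right 1 (2 * x), hy.2]
    have h3 : ‖(t : ℂ) ^ (m + 1)‖ ≤ 1 := by
      rw [norm_pow, Complex.norm_real, Real.norm_of_nonneg h0]
      exact pow_le_one₀ h0 h1
    rw [norm_mul]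
    nlinarith [norm_nonneg (deriv φ (1 + t * (y - 1)))]
  · exact intervalIntegrable_const
  · refine Filter.Eventually.of_forall fun t ht y hy => ?_
    have hy0 : 0 < y := by linarith [hy.1]
    have hd : HasDerivAt φ (deriv φ (1 + t * (y - 1))) (1 + t * (y - 1)) :=
      (hφ'.1.differentiableAt (isOpen_Ioi.mem_nhds (hpos y hy0 t (hsub ht)))).hasDerivAt
    have hl : HasDerivAt (fun y : ℝ => 1 + t * (y - 1)) t y := by
      simpa using (((hasDerivAt_id y).sub_const 1).const_mul t).const_add 1
    have := (hd.scomp y hl).const_mul ((t : ℂ) ^ m)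
    rw [Complex.real_smul, ← mul_assoc, ← pow_succ] at this
    exact this

theorem contDiffOn_integral_pow_mul_segment (n : ℕ) {φ : ℝ → ℂ}
    (hφ : ContDiffOn ℝ (⊤ : ℕ∞) φ (Set.Ioi 0)) (m : ℕ) :
    ContDiffOn ℝ n (fun x : ℝ => ∫ t in (0 : ℝ)..1, (t : ℂ) ^ m * φ (1 + t * (x - 1)))
      (Set.Ioi 0) := by
  induction n generalizing φ m with
  | zero =>
    exact contDiffOn_zero.2 fun x hx =>
      (hasDerivAt_integral_pow_mul_segment hφ m hx).continuousAt.continuousWithinAt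
  | succ n ih =>
    rw [Nat.cast_succ]
    refine (contDiffOn_succ_iff_deriv_of_isOpen isOpen_Ioi).2 ⟨fun x hx =>
      (hasDerivAt_integral_pow_mul_segment hφ m hx).differentiableAt.differentiableWithinAt,
      by simp, ?_⟩
    exact (ih ((contDiffOn_infty_iff_deriv_of_isOpen isOpen_Ioi).1 hφ).2 (m + 1)).congr
      fun x hx => (hasDerivAt_integral_pow_mul_segment hφ m hx).deriv

/-- Hadamard's lemma at the point `1`, for functions smooth away from the origin. -/
theorem contDiffOn_div_sub_one {g : ℝ → ℂ} (hg : ContDiffOn ℝ (⊤ : ℕ∞) g {(0 : ℝ)}ᶜ)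
    (hg1 : g 1 = 0) :
    ContDiffOn ℝ (⊤ : ℕ∞)
      (fun ξ : ℝ => if ξ = 1 then deriv g 1 else g ξ / ((ξ : ℂ) - 1)) {(0 : ℝ)}ᶜ := by
  have hsub : Set.Ioi (0 : ℝ) ⊆ {0}ᶜ := fun x hx => ne_of_gt hx
  have hg' := (contDiffOn_infty_iff_deriv_of_isOpen isOpen_Ioi).1 (hg.mono hsub)
  have key : ContDiffOn ℝ (⊤ : ℕ∞)
      (fun ξ : ℝ => if ξ = 1 then deriv g 1 else g ξ / ((ξ : ℂ) - 1)) (Set.Ioi 0) := by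
    refine (contDiffOn_infty.2 fun n =>
      contDiffOn_integral_pow_mul_segment n hg'.2 0).congr fun x hx => ?_
    split_ifs with h
    · simp [h]
    · have hx1 : x - 1 ≠ 0 := sub_ne_zero.2 h
      have hseg : Set.uIcc 1 x ⊆ Set.Ioi 0 := by
        intro y hy
        exact lt_of_lt_of_le (lt_min one_pos hx) hy.1
      have hI := intervalIntegral.integral_deriv_eq_sub (f := g) (a := 1) (b := x)
        (fun y hy => hg'.1.differentiableAt (isOpen_Ioi.mem_nhds (hseg hy)))
        (hg'.2.continuousOn.mono hseg).intervalIntegrable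
      have hc := intervalIntegral.smul_integral_comp_add_mul (a := 0) (b := 1) (deriv g) (x - 1) 1
      simp only [mul_zero, add_zero, mul_one, add_sub_cancel] at hc
      rw [hI, hg1, sub_zero] at hc
      have hx1' : (x : ℂ) - 1 ≠ 0 := by exact_mod_cast hx1
      rw [div_eq_iff hx1', ← hc]
      simp [mul_comm]
  intro x hx
  by_cases h : x = 1
  · exact (key.contDiffAt (isOpen_Ioi.mem_nhds (by simp [h]))).contDiffWithinAt
  · have hx1 : (x : ℂ) - 1 ≠ 0 := by exact_mod_cast sub_ne_zero.2 h
    have h1 : ContDiffAt ℝ (⊤ : ℕ∞) (fun ξ : ℝ => g ξ * ((ξ : ℂ) - 1)⁻¹) x :=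
      (hg.contDiffAt (isOpen_compl_singleton.mem_nhds hx)).mul
        ((Complex.ofRealCLM.contDiff.contDiffAt.sub contDiffAt_const).inv hx1)
    refine (h1.congr_of_eventuallyEq ?_).contDiffWithinAt
    filter_upwards [isOpen_ne.mem_nhds h] with y hy
    simp [show y ≠ 1 from hy, div_eq_mul_inv]

/-- The space of functions `ℝ → ℂ` that are smooth away from the origin. -/
def smoothAway : Submodule ℂ (ℝ → ℂ) where
  carrier := {f | ContDiffOn ℝ (⊤ : ℕ∞) f {(0 : ℝ)}ᶜ}
  add_mem' := fun hf hg => hf.add hg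
  zero_mem' := contDiffOn_const
  smul_mem' := fun _ _ hf => contDiffOn_const.smul hf

namespace smoothAway

theorem deriv_mem {f : ℝ → ℂ} (hf : f ∈ smoothAway) : deriv f ∈ smoothAway :=
  ((contDiffOn_infty_iff_deriv_of_isOpen isOpen_compl_singleton).1 hf).2

theorem differentiableAt {f : ℝ → ℂ} (hf : f ∈ smoothAway) {ξ : ℝ} (hξ : ξ ≠ 0) :
    DifferentiableAt ℝ f ξ :=
  ((contDiffOn_infty_iff_deriv_of_isOpen isOpen_compl_singleton).1 hf).1.differentiableAt
    (isOpen_compl_singleton.mem_nhds hξ)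

theorem hasDerivAt {f : ℝ → ℂ} (hf : f ∈ smoothAway) {ξ : ℝ} (hξ : ξ ≠ 0) :
    HasDerivAt f (deriv f ξ) ξ :=
  (differentiableAt hf hξ).hasDerivAt

theorem contDiffOn_ofReal (s : Set ℝ) : ContDiffOn ℝ (⊤ : ℕ∞) (fun ξ : ℝ => (ξ : ℂ)) s :=
  Complex.ofRealCLM.contDiff.contDiffOn

theorem calX_mem {f : ℝ → ℂ} (hf : f ∈ smoothAway) : calX f ∈ smoothAway :=
  (contDiffOn_const.mul (contDiffOn_ofReal _)).mul (deriv_mem hf)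

theorem calU_mem (ν : ℂ) {f : ℝ → ℂ} (hf : f ∈ smoothAway) : calU ν f ∈ smoothAway := by
  have hinv : ContDiffOn ℝ (⊤ : ℕ∞) (fun ξ : ℝ => (ν ^ 2 - 1) / (4 * (ξ : ℂ))) {(0 : ℝ)}ᶜ := by
    simp only [div_eq_mul_inv]
    exact contDiffOn_const.mul ((contDiffOn_const.mul (contDiffOn_ofReal _)).inv
      fun x hx => mul_ne_zero (by norm_num) (Complex.ofReal_ne_zero.2 hx))
  exact contDiffOn_const.mul
    ((hinv.mul hf).sub ((contDiffOn_ofReal _).mul (deriv_mem (deriv_mem hf))))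

theorem deriv_deriv_eq {f g : ℝ → ℂ} {ξ : ℝ} (hξ : ξ ≠ 0) (h : ∀ η ≠ 0, deriv f η = g η) :
    deriv (deriv f) ξ = deriv g ξ := by
  apply Filter.EventuallyEq.deriv_eq
  filter_upwards [isOpen_ne.mem_nhds hξ] with η hη using h η hη

theorem deriv_add {f g : ℝ → ℂ} (hf : f ∈ smoothAway) (hg : g ∈ smoothAway) {ξ : ℝ}
    (hξ : ξ ≠ 0) : deriv (f + g) ξ = deriv f ξ + deriv g ξ :=
  ((hasDerivAt hf hξ).add (hasDerivAt hg hξ)).deriv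

theorem deriv_const_smul (c : ℂ) {f : ℝ → ℂ} (hf : f ∈ smoothAway) {ξ : ℝ}
    (hξ : ξ ≠ 0) : deriv (c • f) ξ = c * deriv f ξ :=
  ((hasDerivAt hf hξ).const_smul c).deriv

theorem deriv_ofReal_mul {f : ℝ → ℂ} (hf : f ∈ smoothAway) {ξ : ℝ} (hξ : ξ ≠ 0) :
    deriv (fun ξ : ℝ => (ξ : ℂ) * f ξ) ξ = f ξ + ξ * deriv f ξ := by
  simpa using ((hasDerivAt_id ξ).ofReal_comp.fun_mul (hasDerivAt hf hξ)).deriv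

/-- `𝒳` as an endomorphism of `smoothAway`. -/
noncomputable def opX : Module.End ℂ smoothAway where
  toFun f := ⟨calX f, calX_mem f.2⟩
  map_add' f g := by
    ext ξ
    rcases eq_or_ne ξ 0 with rfl | hξ
    · simp [calX]
    · simp only [calX, Submodule.coe_add, Pi.add_apply, deriv_add f.2 g.2 hξ]
      ring
  map_smul' c f := by
    ext ξ
    rcases eq_or_ne ξ 0 with rfl | hξ
    · simp [calX]
    · simp only [calX, Submodule.coe_smul, Pi.smul_apply, deriv_const_smul c f.2 hξ,
        smul_eq_mul, RingHom.id_apply]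
      ring

/-- `𝒰` as an endomorphism of `smoothAway`. -/
noncomputable def opU (ν : ℂ) : Module.End ℂ smoothAway where
  toFun f := ⟨calU ν f, calU_mem ν f.2⟩
  map_add' f g := by
    ext ξ
    rcases eq_or_ne ξ 0 with rfl | hξ
    · simp [calU]
    · have h : deriv (deriv ((f : ℝ → ℂ) + (g : ℝ → ℂ))) ξ =
          deriv (deriv f) ξ + deriv (deriv g) ξ := by
        rw [deriv_deriv_eq hξ fun η hη => deriv_add f.2 g.2 hη]
        exact deriv_add (deriv_mem f.2) (deriv_mem g.2) hξ
      simp only [calU, Submodule.coe_add, Pi.add_apply, h]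
      ring
  map_smul' c f := by
    ext ξ
    rcases eq_or_ne ξ 0 with rfl | hξ
    · simp [calU]
    · have h : deriv (deriv (c • (f : ℝ → ℂ))) ξ = c * deriv (deriv f) ξ := by
        rw [deriv_deriv_eq hξ fun η hη => deriv_const_smul c f.2 hη]
        exact deriv_const_smul c (deriv_mem f.2) hξ
      simp only [calU, Submodule.coe_smul, Pi.smul_apply, h, smul_eq_mul, RingHom.id_apply]
      ring

/-- Multiplication by the variable, as an endomorphism of `smoothAway`. -/
noncomputable def opM : Module.End ℂ smoothAway where
  toFun f := ⟨fun ξ => (ξ : ℂ) * (f : ℝ → ℂ) ξ, (contDiffOn_ofReal _).mul f.2⟩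
  map_add' f g := by
    ext ξ
    simp [mul_add]
  map_smul' c f := by
    ext ξ
    simp [mul_left_comm]

theorem opX_apply (f : smoothAway) (ξ : ℝ) :
    (opX f : ℝ → ℂ) ξ = -2 * ξ * deriv f ξ := rfl

theorem opU_apply (ν : ℂ) (f : smoothAway) (ξ : ℝ) : (opU ν f : ℝ → ℂ) ξ =
    I * ((ν ^ 2 - 1) / (4 * ξ) * (f : ℝ → ℂ) ξ - ξ * deriv (deriv f) ξ) := rfl

theorem opM_apply (f : smoothAway) (ξ : ℝ) : (opM f : ℝ → ℂ) ξ = ξ * (f : ℝ → ℂ) ξ := rfl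

theorem deriv_opX (f : smoothAway) {ξ : ℝ} (hξ : ξ ≠ 0) :
    deriv (opX f : ℝ → ℂ) ξ = -2 * deriv f ξ - 2 * ξ * deriv (deriv f) ξ := by
  have h := deriv_ofReal_mul ((smoothAway.smul_mem (-2) (deriv_mem f.2))) hξ
  rw [deriv_const_smul _ (deriv_mem f.2) hξ] at h
  simp only [Pi.smul_apply, smul_eq_mul] at h
  rw [show (opX f : ℝ → ℂ) = fun ξ : ℝ => (ξ : ℂ) * (-2 * deriv f ξ) from
    funext fun ξ => by rw [opX_apply]; ring, h]
  ring

theorem opX_mul_opM : opX * opM = opM * (opX + algebraMap ℂ _ (-2)) := by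
  ext f ξ
  rcases eq_or_ne ξ 0 with rfl | hξ
  · simp [opX_apply, opM_apply]
  · have h : deriv (opM f : ℝ → ℂ) ξ = _ := deriv_ofReal_mul f.2 hξ
    rw [Module.End.mul_apply, opX_apply, h, Module.End.mul_apply, opM_apply]
    simp only [LinearMap.add_apply, Submodule.coe_add, Pi.add_apply, opX_apply,
      Module.algebraMap_end_apply, Submodule.coe_smul, Pi.smul_apply, smul_eq_mul]
    ring

theorem opU_mul_opM (ν : ℂ) : opU ν * opM = opM * opU ν + I • opX := by
  ext f ξ
  rcases eq_or_ne ξ 0 with rfl | hξ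
  · simp [opX_apply, opM_apply, opU_apply]
  · have h : deriv (deriv (opM f : ℝ → ℂ)) ξ = 2 * deriv f ξ + ξ * deriv (deriv f) ξ := by
      rw [deriv_deriv_eq hξ fun η hη =>
        show deriv (opM f : ℝ → ℂ) η = _ from deriv_ofReal_mul f.2 hη]
      refine ((hasDerivAt f.2 hξ).add
        ((hasDerivAt_id ξ).ofReal_comp.mul (hasDerivAt (deriv_mem f.2) hξ))).deriv.trans ?_
      simp
      ring
    simp only [Module.End.mul_apply, LinearMap.add_apply, LinearMap.smul_apply,
      Submodule.coe_add, Submodule.coe_smul, Pi.add_apply, Pi.smul_apply, smul_eq_mul,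
      opU_apply, h, opM_apply, opX_apply]
    ring

theorem opX_mul_opU (ν : ℂ) : opX * opU ν = opU ν * opX + (2 : ℂ) • opU ν := by
  ext f ξ
  rcases eq_or_ne ξ 0 with rfl | hξ
  · simp [opX_apply, opU_apply]
  · have hξ' : (ξ : ℂ) ≠ 0 := Complex.ofReal_ne_zero.2 hξ
    have h1 := deriv_mem f.2
    have h2 := deriv_mem h1
    have h : deriv (deriv (opX f : ℝ → ℂ)) ξ =
        -4 * deriv (deriv f) ξ - 2 * ξ * deriv (deriv (deriv f)) ξ := by
      rw [deriv_deriv_eq hξ fun η hη => deriv_opX f hη]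
      refine (((hasDerivAt h1 hξ).const_mul (-2)).sub
        (((hasDerivAt_id ξ).ofReal_comp.const_mul 2).mul (hasDerivAt h2 hξ))).deriv.trans ?_
      simp
      ring
    have hU : deriv (opU ν f : ℝ → ℂ) ξ = I * ((ν ^ 2 - 1) / (4 * ξ) * deriv f ξ
        - (ν ^ 2 - 1) / (4 * ξ ^ 2) * (f : ℝ → ℂ) ξ
        - deriv (deriv f) ξ - ξ * deriv (deriv (deriv f)) ξ) := by
      have hi : HasDerivAt (fun ξ : ℝ => (ν ^ 2 - 1) / (4 * (ξ : ℂ)))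
          (-((ν ^ 2 - 1) / (4 * ξ ^ 2))) ξ := by
        have := ((hasDerivAt_id ξ).ofReal_comp.const_mul 4).fun_inv
          (mul_ne_zero (by norm_num) hξ') |>.const_mul (ν ^ 2 - 1)
        simp only [id, ← div_eq_mul_inv] at this
        refine this.congr_deriv ?_
        push_cast
        field_simp
      refine (((hi.mul (hasDerivAt f.2 hξ)).sub
        ((hasDerivAt_id ξ).ofReal_comp.mul (hasDerivAt h2 hξ))).const_mul I).deriv.trans ?_
      simp
      ring
    simp only [Module.End.mul_apply, LinearMap.add_apply, LinearMap.smul_apply,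
      Submodule.coe_add, Submodule.coe_smul, Pi.add_apply, Pi.smul_apply, smul_eq_mul]
    rw [opX_apply, hU, opU_apply, h, opX_apply, opU_apply]
    field_simp
    ring

section Commutation

variable {A : Type*} [Ring A] [Algebra ℂ A] {X U M : A}

theorem mul_pow_of_mul_eq (hXU : X * U = U * X + (2 : ℂ) • U) (b : ℕ) :
    X * U ^ b = U ^ b * X + (2 * b : ℂ) • U ^ b := by
  induction b with
  | zero => simp
  | succ b ih =>
    rw [pow_succ, ← mul_assoc, ih, add_mul, mul_assoc, hXU, smul_mul_assoc, mul_add,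
      mul_smul_comm]
    push_cast
    simp only [mul_assoc]
    module

theorem pow_succ_mul_of_mul_eq (hXU : X * U = U * X + (2 : ℂ) • U)
    (hUM : U * M = M * U + I • X) (b : ℕ) :
    U ^ (b + 1) * M = M * U ^ (b + 1) +
      ((I * (b + 1)) • (U ^ b * X) + (I * b * (b + 1)) • U ^ b) := by
  have h := mul_pow_of_mul_eq hXU
  induction b with
  | zero => simp [hUM]
  | succ b ih =>
    rw [pow_succ' U (b + 1), mul_assoc, ih, mul_add, ← mul_assoc, hUM, add_mul, smul_mul_assoc,
      h (b + 1), mul_add, mul_smul_comm, mul_smul_comm, ← mul_assoc, ← pow_succ', mul_assoc]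
    push_cast
    module

theorem mul_pow_of_semiconj (hXM : X * M = M * (X + algebraMap ℂ A (-2))) (b : ℕ) :
    X * M ^ b = M ^ b * (X + algebraMap ℂ A (-(2 * b))) := by
  induction b with
  | zero => simp
  | succ b ih =>
    rw [pow_succ, ← mul_assoc, ih, mul_assoc, add_mul, hXM, Algebra.commutes, ← mul_add,
      ← mul_assoc, add_assoc, ← map_add,
      show (-2 : ℂ) + -(2 * b) = -(2 * (b + 1 : ℕ)) by push_cast; ring]

theorem pow_mul_of_semiconj (hXM : X * M = M * (X + algebraMap ℂ A (-2))) (n : ℕ) :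
    X ^ n * M = M * (X + algebraMap ℂ A (-2)) ^ n :=
  ((show SemiconjBy M (X + algebraMap ℂ A (-2)) X from hXM.symm).pow_right n).symm

/-- The coefficients of `(X - 2) ^ n`. -/
def subTwoCoeff (n m : ℕ) : ℂ := (-2) ^ (n - m) * n.choose m

theorem add_algebraMap_pow (n : ℕ) :
    (X + algebraMap ℂ A (-2)) ^ n = ∑ m ∈ range (n + 1), subTwoCoeff n m • X ^ m := by
  rw [(Algebra.commute_algebraMap_right (-2 : ℂ) X).add_pow]
  refine sum_congr rfl fun m _ => ?_
  rw [subTwoCoeff, mul_assoc, ← map_pow, ← map_natCast (algebraMap ℂ A), ← map_mul,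
    ← Algebra.commutes, ← Algebra.smul_def]

theorem add_algebraMap_pow_succ (n : ℕ) :
    (X + algebraMap ℂ A (-2)) ^ (n + 1) = X ^ (n + 1) - (2 * (n + 1) : ℂ) • X ^ n +
      ∑ m ∈ range n, subTwoCoeff (n + 1) m • X ^ m := by
  rw [add_algebraMap_pow, sum_range_succ, sum_range_succ]
  simp [subTwoCoeff]
  module

/-- The commutator identity behind the Euler-type equation satisfied by `U ^ b * X ^ n`. -/
theorem euler_identity (hXU : X * U = U * X + (2 : ℂ) • U)
    (hXM : X * M = M * (X + algebraMap ℂ A (-2))) (b n : ℕ) :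
    (M - 1) * (X * (U ^ b * X ^ n) - (2 * b : ℂ) • (U ^ b * X ^ n))
        - (2 * (n + 1) : ℂ) • (M * (U ^ b * X ^ n)) =
      U ^ b * X ^ (n + 1) * (M - 1)
        - M * ∑ m ∈ range n, subTwoCoeff (n + 1) m • (U ^ b * X ^ m)
        - (U ^ b * M - M * U ^ b) * (X + algebraMap ℂ A (-2)) ^ (n + 1) := by
  have h1 : X * (U ^ b * X ^ n) - (2 * b : ℂ) • (U ^ b * X ^ n) = U ^ b * X ^ (n + 1) := by
    rw [← mul_assoc, mul_pow_of_mul_eq hXU, add_mul, smul_mul_assoc, mul_assoc, ← pow_succ']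
    module
  have h2 : ∑ m ∈ range n, subTwoCoeff (n + 1) m • (U ^ b * X ^ m) =
      U ^ b * ∑ m ∈ range n, subTwoCoeff (n + 1) m • X ^ m := by
    simp [mul_sum]
  rw [h1, h2, mul_sub (U ^ b * X ^ (n + 1)), mul_assoc (U ^ b) (X ^ (n + 1)) M,
    pow_mul_of_semiconj hXM, sub_mul (U ^ b * M), add_algebraMap_pow_succ]
  simp only [mul_assoc, mul_add, mul_sub, sub_mul, mul_smul_comm, one_mul, mul_one]
  module

theorem euler_identity_zero (hXU : X * U = U * X + (2 : ℂ) • U)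
    (hXM : X * M = M * (X + algebraMap ℂ A (-2))) (n : ℕ) :
    (M - 1) * (X * (U ^ 0 * X ^ n) - (2 * (0 : ℕ) : ℂ) • (U ^ 0 * X ^ n))
        - (2 * (n + 1) : ℂ) • (M * (U ^ 0 * X ^ n)) =
      U ^ 0 * X ^ (n + 1) * (M - 1)
        - M * ∑ m ∈ range n, subTwoCoeff (n + 1) m • (U ^ 0 * X ^ m) := by
  rw [euler_identity hXU hXM]
  simp

theorem euler_identity_succ (hXU : X * U = U * X + (2 : ℂ) • U) (hUM : U * M = M * U + I • X)
    (hXM : X * M = M * (X + algebraMap ℂ A (-2))) (b n : ℕ) :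
    (M - 1) * (X * (U ^ (b + 1) * X ^ n) - (2 * (b + 1 : ℕ) : ℂ) • (U ^ (b + 1) * X ^ n))
        - (2 * (n + 1) : ℂ) • (M * (U ^ (b + 1) * X ^ n)) =
      U ^ (b + 1) * X ^ (n + 1) * (M - 1)
        - M * ∑ m ∈ range n, subTwoCoeff (n + 1) m • (U ^ (b + 1) * X ^ m)
        - ∑ m ∈ range (n + 2), subTwoCoeff (n + 1) m •
          ((I * (b + 1)) • (U ^ b * X ^ (m + 1)) + (I * b * (b + 1)) • (U ^ b * X ^ m)) := by
  rw [euler_identity hXU hXM, pow_succ_mul_of_mul_eq hXU hUM, add_sub_cancel_left,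
    add_algebraMap_pow]
  congr 1
  rw [mul_sum]
  refine sum_congr rfl fun m _ => ?_
  rw [mul_smul_comm, add_mul, smul_mul_assoc, smul_mul_assoc, mul_assoc, ← pow_succ']

/-- Conjugating by `M ^ b` removes the zeroth-order term `2b` of the Euler-type equation. -/
theorem euler_equation_conj (hXM : X * M = M * (X + algebraMap ℂ A (-2))) {P Q : A} {b : ℕ}
    {c : ℂ} (h : (M - 1) * (X * P - (2 * b : ℂ) • P) - c • (M * P) = Q) :
    M * (X * (M ^ b * P)) - X * (M ^ b * P) - c • (M * (M ^ b * P)) = M ^ b * Q := by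
  have hX : X * (M ^ b * P) = M ^ b * (X * P - (2 * b : ℂ) • P) := by
    rw [← mul_assoc, mul_pow_of_semiconj hXM, mul_assoc, add_mul, ← Algebra.smul_def,
      neg_smul (2 * b : ℂ) P, sub_eq_add_neg]
  rw [← h, hX, ← mul_assoc M, ← mul_assoc M, ← pow_succ', pow_succ]
  simp only [sub_mul, mul_sub, mul_smul_comm, one_mul, mul_assoc]
  module

end Commutation

/-- The interval `I = [1/2, 3/2]`. -/
abbrev unitNbhd : Set ℝ := Set.Icc (1 / 2) (3 / 2)

/-- The unweighted `L²` norm on `[1/2, 3/2]`. -/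
noncomputable def normI (f : ℝ → ℂ) : ENNReal := eLpNorm f 2 (volume.restrict unitNbhd)

theorem ne_zero_of_mem_unitNbhd {ξ : ℝ} (hξ : ξ ∈ unitNbhd) : ξ ≠ 0 := by
  have := hξ.1
  intro h
  norm_num [h] at this

theorem continuousOn_unitNbhd {f : ℝ → ℂ} (hf : f ∈ smoothAway) : ContinuousOn f unitNbhd :=
  (ContDiffOn.continuousOn hf).mono fun _ hξ => ne_zero_of_mem_unitNbhd hξ

theorem aestronglyMeasurable {f : ℝ → ℂ} (hf : f ∈ smoothAway) :
    AEStronglyMeasurable f (volume.restrict unitNbhd) :=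
  (continuousOn_unitNbhd hf).aestronglyMeasurable measurableSet_Icc

theorem normI_add_le (f g : smoothAway) : normI ((f + g : smoothAway) : ℝ → ℂ) ≤
    normI (f : ℝ → ℂ) + normI (g : ℝ → ℂ) :=
  eLpNorm_add_le (aestronglyMeasurable f.2) (aestronglyMeasurable g.2) (by norm_num)

theorem normI_smul (c : ℂ) (f : ℝ → ℂ) : normI (c • f) = ‖c‖ₑ * normI f :=
  eLpNorm_const_smul c f 2 _

theorem normI_opM_le (f : smoothAway) : normI (opM f : ℝ → ℂ) ≤ 2 * normI (f : ℝ → ℂ) := by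
  have : ∀ᵐ ξ ∂volume.restrict unitNbhd,
      ‖(opM f : ℝ → ℂ) ξ‖₊ ≤ 2 * ‖(f : ℝ → ℂ) ξ‖₊ := by
    filter_upwards [ae_restrict_mem measurableSet_Icc] with ξ hξ
    rw [opM_apply, nnnorm_mul]
    gcongr
    rw [← NNReal.coe_le_coe, coe_nnnorm, Complex.norm_real, Real.norm_of_nonneg]
    · have := hξ.2; norm_num at this ⊢; linarith
    · have := hξ.1; norm_num at this ⊢; linarith
  simpa [normI, ENNReal.smul_def] using eLpNorm_le_nnreal_smul_eLpNorm_of_ae_le_mul this 2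

theorem normI_le_opM (f : smoothAway) : normI (f : ℝ → ℂ) ≤ 2 * normI (opM f : ℝ → ℂ) := by
  have : ∀ᵐ ξ ∂volume.restrict unitNbhd,
      ‖(f : ℝ → ℂ) ξ‖ ≤ 2 * ‖(opM f : ℝ → ℂ) ξ‖ := by
    filter_upwards [ae_restrict_mem measurableSet_Icc] with ξ hξ
    have h1 := hξ.1
    rw [opM_apply, norm_mul, Complex.norm_real, Real.norm_of_nonneg (by linarith)]
    nlinarith [norm_nonneg ((f : ℝ → ℂ) ξ)]
  simpa [normI] using eLpNorm_le_mul_eLpNorm_of_ae_le_mul this 2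

theorem normI_opM_pow_le (b : ℕ) (f : smoothAway) :
    normI ((opM ^ b) f : ℝ → ℂ) ≤ 2 ^ b * normI (f : ℝ → ℂ) := by
  induction b with
  | zero => simp
  | succ b ih =>
    rw [pow_succ', pow_succ', Module.End.mul_apply, mul_assoc]
    exact (normI_opM_le _).trans (by gcongr)

theorem normI_le_opM_pow (b : ℕ) (f : smoothAway) :
    normI (f : ℝ → ℂ) ≤ 2 ^ b * normI ((opM ^ b) f : ℝ → ℂ) := by
  induction b with
  | zero => simp
  | succ b ih =>
    rw [pow_succ' opM, pow_succ (2 : ENNReal), Module.End.mul_apply, mul_assoc]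
    exact ih.trans (mul_le_mul_right (normI_le_opM _) _)

theorem normI_eq_ofReal (f : smoothAway) : normI (f : ℝ → ℂ) =
    ENNReal.ofReal ((∫ ξ in unitNbhd, ‖(f : ℝ → ℂ) ξ‖ ^ 2) ^ (1 / 2 : ℝ)) := by
  have hm : MemLp (f : ℝ → ℂ) 2 (volume.restrict unitNbhd) :=
    (memLp_two_iff_integrable_sq_norm (aestronglyMeasurable f.2)).2
      (((continuousOn_unitNbhd f.2).norm.pow 2).integrableOn_Icc)
  rw [normI, hm.eLpNorm_eq_integral_rpow_norm (by norm_num) (by norm_num)]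
  norm_num

/-- A Hardy-type inequality for the Euler operator `(ξ - 1)∂ + m` on `[1/2, 3/2]`. -/
theorem normI_le_of_euler (m : ℕ) (hm : 1 ≤ m) (h k : smoothAway)
    (e : opM (opX h) - opX h - (2 * m : ℂ) • opM h = k) :
    normI (h : ℝ → ℂ) ≤ 2 * normI (k : ℝ → ℂ) := by
  have hpt : ∀ ξ : ℝ, -2 * (ξ : ℂ) * ((ξ - 1) * deriv h ξ + m * (h : ℝ → ℂ) ξ) =
      (k : ℝ → ℂ) ξ := by
    intro ξ
    rw [← e]
    simp only [Submodule.coe_sub, Submodule.coe_smul, Pi.sub_apply, Pi.smul_apply, smul_eq_mul,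
      opM_apply, opX_apply]
    ring
  set u : ℝ → ℂ := (h : ℝ → ℂ)
  set v : ℝ → ℂ := (k : ℝ → ℂ)
  have hu : u ∈ smoothAway := h.2
  have hv : v ∈ smoothAway := k.2
  set p : ℝ → ℝ := fun ξ => (ξ - 1) * ‖u ξ‖ ^ 2
  set q : ℝ → ℝ := fun ξ => ‖u ξ‖ ^ 2 + (ξ - 1) * (2 * inner ℝ (u ξ) (deriv u ξ))
  have hI : Set.uIcc (1 / 2 : ℝ) (3 / 2) = unitNbhd := Set.uIcc_of_le (by norm_num)
  have hp : ∀ ξ ∈ Set.uIcc (1 / 2 : ℝ) (3 / 2), HasDerivAt p (q ξ) ξ := by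
    intro ξ hξ
    rw [hI] at hξ
    have h1 := (hasDerivAt hu (ne_zero_of_mem_unitNbhd hξ)).norm_sq
    refine (((hasDerivAt_id ξ).sub_const 1).fun_mul h1).congr_deriv ?_
    simp only [q, one_mul, id]
  have hcu := continuousOn_unitNbhd hu
  have hcv := continuousOn_unitNbhd hv
  have hqc : ContinuousOn q unitNbhd :=
    (hcu.norm.pow 2).add ((by fun_prop : ContinuousOn (fun ξ : ℝ => ξ - 1) unitNbhd).mul
      (continuousOn_const.mul (ContinuousOn.inner (𝕜 := ℝ) hcu
        (continuousOn_unitNbhd (deriv_mem hu)))))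
  have hqle : ∀ ξ ∈ unitNbhd, q ξ ≤ 2 * ‖v ξ‖ ^ 2 - 1 / 2 * ‖u ξ‖ ^ 2 := by
    intro ξ hξ
    have hξ1 : 1 / 2 ≤ ξ := hξ.1
    have h1 : inner ℝ (u ξ) (v ξ) =
        -2 * ξ * ((ξ - 1) * inner ℝ (u ξ) (deriv u ξ) + m * ‖u ξ‖ ^ 2) := by
      rw [← hpt ξ, show -2 * (ξ : ℂ) * ((ξ - 1) * deriv u ξ + m * u ξ) =
        (-2 * ξ : ℝ) • ((ξ - 1 : ℝ) • deriv u ξ + (m : ℝ) • u ξ) by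
          simp only [Complex.real_smul]; push_cast; ring]
      simp only [inner_smul_right, inner_add_right, real_inner_self_eq_norm_sq]
    have h2 : -(‖u ξ‖ * ‖v ξ‖) ≤ inner ℝ (u ξ) (v ξ) :=
      neg_le_of_abs_le (abs_real_inner_le_norm _ _)
    have hm' : (1 : ℝ) ≤ m := by exact_mod_cast hm
    have h3 : (ξ - 1) * inner ℝ (u ξ) (deriv u ξ) + m * ‖u ξ‖ ^ 2 ≤ ‖u ξ‖ * ‖v ξ‖ := by
      by_contra! hc
      nlinarith [mul_nonneg (norm_nonneg (u ξ)) (norm_nonneg (v ξ))]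
    have h4 : ‖u ξ‖ ^ 2 ≤ m * ‖u ξ‖ ^ 2 := le_mul_of_one_le_left (sq_nonneg _) hm'
    simp only [q]
    nlinarith [sq_nonneg (‖u ξ‖ - 2 * ‖v ξ‖)]
  have hFTC := intervalIntegral.integral_eq_sub_of_hasDerivAt hp
    (ContinuousOn.intervalIntegrable (hI ▸ hqc))
  rw [intervalIntegral.integral_of_le (by norm_num), ← integral_Icc_eq_integral_Ioc] at hFTC
  have hp0 : 0 ≤ p (3 / 2) - p (1 / 2) := by
    simp only [p]
    nlinarith [sq_nonneg ‖u (3 / 2)‖, sq_nonneg ‖u (1 / 2)‖]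
  have hiu : IntegrableOn (fun ξ => ‖u ξ‖ ^ 2) unitNbhd := (hcu.norm.pow 2).integrableOn_Icc
  have hiv : IntegrableOn (fun ξ => ‖v ξ‖ ^ 2) unitNbhd := (hcv.norm.pow 2).integrableOn_Icc
  have hle := setIntegral_mono_on hqc.integrableOn_Icc
    ((hiv.const_mul 2).sub (hiu.const_mul (1 / 2))) measurableSet_Icc hqle
  simp only [Pi.sub_apply] at hle
  rw [integral_sub (hiv.const_mul 2) (hiu.const_mul (1 / 2)), integral_const_mul,
    integral_const_mul, hFTC] at hle
  have hfin : ∫ ξ in unitNbhd, ‖u ξ‖ ^ 2 ≤ 2 ^ 2 * ∫ ξ in unitNbhd, ‖v ξ‖ ^ 2 := by linarith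
  rw [normI_eq_ofReal, normI_eq_ofReal, show (2 : ENNReal) = ENNReal.ofReal 2 by simp,
    ← ENNReal.ofReal_mul (by norm_num)]
  refine ENNReal.ofReal_le_ofReal ((Real.rpow_le_rpow (by positivity) hfin
    (by norm_num)).trans_eq ?_)
  rw [Real.mul_rpow (by norm_num) (by positivity), ← Real.sqrt_eq_rpow, Real.sqrt_sq (by norm_num)]

theorem L2w_le_normI (f : ℝ → ℂ) : L2w f unitNbhd ≤ 2 * normI f := by
  have : ∫⁻ ξ in unitNbhd, ENNReal.ofReal (‖f ξ‖ ^ 2) / ENNReal.ofReal |ξ| ≤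
      2 ^ (2 : ℝ) * ∫⁻ ξ in unitNbhd, ‖f ξ‖ₑ ^ (2 : ℝ) := by
    rw [← lintegral_const_mul' _ _ (by norm_num)]
    refine setLIntegral_mono_ae' measurableSet_Icc (Filter.Eventually.of_forall fun ξ hξ => ?_)
    have h1 : 1 / 4 ≤ |ξ| := by rw [abs_of_nonneg] <;> linarith [hξ.1]
    have h2 : ENNReal.ofReal (1 / 4) ≤ ENNReal.ofReal |ξ| := ENNReal.ofReal_le_ofReal h1
    refine (ENNReal.div_le_div_left h2 _).trans_eq ?_
    rw [ENNReal.ofReal_pow (norm_nonneg _), ofReal_norm, ENNReal.div_eq_inv_mul,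
      ← ENNReal.ofReal_inv_of_pos (by norm_num)]
    norm_num
  rw [L2w, normI, eLpNorm_eq_lintegral_rpow_enorm_toReal (by norm_num) (by norm_num)]
  refine (ENNReal.rpow_le_rpow this (by norm_num)).trans_eq ?_
  rw [ENNReal.mul_rpow_of_nonneg _ _ (by norm_num), ← ENNReal.rpow_mul]
  norm_num

theorem normI_le_L2w (f : ℝ → ℂ) : normI f ≤ 2 * L2w f Set.univ := by
  have : ∫⁻ ξ in unitNbhd, ‖f ξ‖ₑ ^ (2 : ℝ) ≤
      2 ^ (2 : ℝ) * ∫⁻ ξ in Set.univ, ENNReal.ofReal (‖f ξ‖ ^ 2) / ENNReal.ofReal |ξ| := by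
    refine le_trans ?_ (mul_le_mul_right (lintegral_mono_set (Set.subset_univ unitNbhd)) _)
    rw [← lintegral_const_mul' _ _ (by norm_num)]
    refine setLIntegral_mono_ae' measurableSet_Icc (Filter.Eventually.of_forall fun ξ hξ => ?_)
    have h1 : |ξ| ≤ 4 := by rw [abs_of_nonneg] <;> linarith [hξ.1, hξ.2]
    have h2 : ENNReal.ofReal |ξ| ≤ ENNReal.ofReal 4 := ENNReal.ofReal_le_ofReal h1
    refine le_trans (le_of_eq ?_) (mul_le_mul_right (ENNReal.div_le_div_left h2 _) _)
    rw [ENNReal.ofReal_pow (norm_nonneg _), ofReal_norm, ← mul_div_assoc]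
    norm_num
    rw [mul_comm, ENNReal.mul_div_cancel_right] <;> norm_num
  rw [L2w, normI, eLpNorm_eq_lintegral_rpow_enorm_toReal (by norm_num) (by norm_num)]
  refine (ENNReal.rpow_le_rpow this (by norm_num)).trans_eq ?_
  rw [ENNReal.mul_rpow_of_nonneg _ _ (by norm_num), ← ENNReal.rpow_mul]
  norm_num

/-- The sum of the `L²` norms on `[1/2, 3/2]` of `𝒰^j 𝒳^k g` over `j + k < n`. -/
noncomputable def sobolevSum (ν : ℂ) (n : ℕ) (g : smoothAway) : ENNReal :=
  ∑ j ∈ range n, ∑ k ∈ range (n - j), normI ((opU ν ^ j * opX ^ k) g : ℝ → ℂ)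

theorem normI_le_sobolevSum (ν : ℂ) {j k n : ℕ} (h : j + k < n) (g : smoothAway) :
    normI ((opU ν ^ j * opX ^ k) g : ℝ → ℂ) ≤ sobolevSum ν n g := by
  refine le_trans ?_ (single_le_sum (fun _ _ => zero_le) (mem_range.2 (by omega : j < n)))
  exact single_le_sum (f := fun k => normI ((opU ν ^ j * opX ^ k) g : ℝ → ℂ))
    (fun _ _ => zero_le) (mem_range.2 (by omega : k < n - j))

theorem sobolevSum_mono (ν : ℂ) {m n : ℕ} (h : m ≤ n) (g : smoothAway) :
    sobolevSum ν m g ≤ sobolevSum ν n g := by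
  refine (sum_le_sum fun j _ => ?_).trans (sum_le_sum_of_subset (range_mono h))
  exact sum_le_sum_of_subset (range_mono (by omega))

/-- The family of operators `A ν` is bounded, uniformly in `ν`, by the norms of order less than
`n` of `(ξ - 1) F`. -/
def Controlled (n : ℕ) (A : ℂ → Module.End ℂ smoothAway) : Prop :=
  ∃ C : NNReal, ∀ ν F, normI (A ν F : ℝ → ℂ) ≤ C * sobolevSum ν n ((opM - 1) F)

namespace Controlled

variable {n : ℕ} {A B : ℂ → Module.End ℂ smoothAway}

theorem mono {m : ℕ} (hA : Controlled m A) (h : m ≤ n) : Controlled n A := by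
  obtain ⟨C, hC⟩ := hA
  exact ⟨C, fun ν F => (hC ν F).trans (mul_le_mul_right (sobolevSum_mono ν h _) _)⟩

theorem add (hA : Controlled n A) (hB : Controlled n B) : Controlled n fun ν => A ν + B ν := by
  obtain ⟨C, hC⟩ := hA
  obtain ⟨D, hD⟩ := hB
  refine ⟨C + D, fun ν F => (normI_add_le _ _).trans ?_⟩
  rw [ENNReal.coe_add, add_mul]
  exact add_le_add (hC ν F) (hD ν F)

theorem smul (c : ℂ) (hA : Controlled n A) : Controlled n fun ν => c • A ν := by
  obtain ⟨C, hC⟩ := hA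
  refine ⟨‖c‖₊ * C, fun ν F => (normI_smul c _).trans_le ?_⟩
  rw [ENNReal.coe_mul, mul_assoc]
  exact mul_le_mul_right (hC ν F) _

theorem sub (hA : Controlled n A) (hB : Controlled n B) : Controlled n fun ν => A ν - B ν := by
  have h : (fun ν => A ν - B ν) = fun ν => A ν + (-1 : ℂ) • B ν := by
    ext
    simp [sub_eq_add_neg]
  exact h ▸ hA.add (hB.smul (-1))

theorem zero : Controlled n fun _ => 0 :=
  ⟨0, fun ν F => by simp [normI]⟩

theorem sum {ι : Type*} (s : Finset ι) (A : ι → ℂ → Module.End ℂ smoothAway)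
    (h : ∀ i ∈ s, Controlled n (A i)) : Controlled n fun ν => ∑ i ∈ s, A i ν := by
  classical
  induction s using Finset.induction_on with
  | empty => simpa using zero
  | insert i s hi ih =>
    simp only [sum_insert hi]
    exact (h i (mem_insert_self i s)).add (ih fun j hj => h j (mem_insert_of_mem hj))

theorem opM_mul (hA : Controlled n A) : Controlled n fun ν => opM * A ν := by
  obtain ⟨C, hC⟩ := hA
  refine ⟨2 * C, fun ν F => (normI_opM_le _).trans ?_⟩
  rw [ENNReal.coe_mul, mul_assoc]
  exact mul_le_mul_right (hC ν F) _

theorem mul_opM_sub_one {j k : ℕ} (h : j + k < n) :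
    Controlled n fun ν => opU ν ^ j * opX ^ k * (opM - 1) :=
  ⟨1, fun ν F => by simpa using normI_le_sobolevSum ν h ((opM - 1) F)⟩

theorem of_euler (b a : ℕ) (hB : Controlled n B)
    (h : ∀ ν, (opM - 1) * (opX * A ν - (2 * b : ℂ) • A ν) -
      (2 * (a + 1) : ℂ) • (opM * A ν) = B ν) : Controlled n A := by
  obtain ⟨C, hC⟩ := hB
  refine ⟨2 ^ b * (2 * (2 ^ b * C)), fun ν F => ?_⟩
  have hop : opM * (opX * (opM ^ b * A ν)) - opX * (opM ^ b * A ν)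
      - (2 * (a + 1 : ℕ) : ℂ) • (opM * (opM ^ b * A ν)) = opM ^ b * B ν := by
    push_cast
    exact euler_equation_conj (A := Module.End ℂ smoothAway) opX_mul_opM (h ν)
  have hE := normI_le_of_euler (a + 1) (by omega) ((opM ^ b * A ν) F) ((opM ^ b * B ν) F)
    (by rw [← hop]; rfl)
  push_cast
  simp only [mul_assoc]
  refine (normI_le_opM_pow b (A ν F)).trans (mul_le_mul_right (hE.trans
    (mul_le_mul_right ((normI_opM_pow_le b (B ν F)).trans (mul_le_mul_right (hC ν F) _)) _)) _)

end Controlled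

theorem controlled_pow (b a : ℕ) :
    Controlled (a + 2 * b + 2) fun ν => opU ν ^ b * opX ^ a := by
  induction b generalizing a with
  | zero =>
    induction a using Nat.strong_induction_on with
    | _ a iha =>
      refine .of_euler 0 a (.sub (.mul_opM_sub_one (j := 0) (k := a + 1) (by omega))
        (.opM_mul (.sum (range a) (fun m ν => subTwoCoeff (a + 1) m • (opU ν ^ 0 * opX ^ m))
          fun m hm => .smul _ ((iha m (mem_range.1 hm)).mono ?_))))
        fun ν => euler_identity_zero (A := Module.End ℂ smoothAway) (opX_mul_opU ν) opX_mul_opM a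
      have := mem_range.1 hm
      omega
  | succ b ihb =>
    induction a using Nat.strong_induction_on with
    | _ a iha =>
      have hcomm : Controlled (a + 2 * (b + 1) + 2) fun ν => ∑ m ∈ range (a + 2),
          subTwoCoeff (a + 1) m • ((I * (b + 1)) • (opU ν ^ b * opX ^ (m + 1)) +
            (I * b * (b + 1)) • (opU ν ^ b * opX ^ m)) := by
        refine .sum _ (fun m ν => subTwoCoeff (a + 1) m •
          ((I * (b + 1)) • (opU ν ^ b * opX ^ (m + 1)) +
            (I * b * (b + 1)) • (opU ν ^ b * opX ^ m))) fun m hm => ?_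
        have := mem_range.1 hm
        exact .smul _ (.add (.smul _ ((ihb (m + 1)).mono (by omega)))
          (.smul _ ((ihb m).mono (by omega))))
      refine .of_euler (b + 1) a (.sub (.sub
        (.mul_opM_sub_one (j := b + 1) (k := a + 1) (by omega))
        (.opM_mul (.sum (range a) (fun m ν => subTwoCoeff (a + 1) m • (opU ν ^ (b + 1) * opX ^ m))
          fun m hm => .smul _ ((iha m (mem_range.1 hm)).mono ?_))))
        hcomm) fun ν => euler_identity_succ (A := Module.End ℂ smoothAway) (opX_mul_opU ν)
          (opU_mul_opM ν) opX_mul_opM b a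
      have := mem_range.1 hm
      omega

theorem coe_pow_mul_pow (ν : ℂ) (b a : ℕ) (f : smoothAway) :
    ((opU ν ^ b * opX ^ a) f : ℝ → ℂ) = (calU ν)^[b] (calX^[a] f) := by
  have hX : ((opX ^ a) f : ℝ → ℂ) = calX^[a] f := by
    induction a with
    | zero => rfl
    | succ a ih => rw [pow_succ', Function.iterate_succ_apply', ← ih]; rfl
  rw [← hX, Module.End.mul_apply]
  induction b with
  | zero => rfl
  | succ b ih => rw [pow_succ', Function.iterate_succ_apply', ← ih]; rfl

end smoothAway

open smoothAway in
/-- Estimate on the interval `I = [1/2, 3/2]` for the solution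
`f(ξ) = (i/λ)·g(ξ)/(ξ−1)` (extended at `ξ = 1` by `f(1) = (i/λ)g′(1)`), for `g` smooth
with `g(1) = 0`:
`‖𝒰^β 𝒳^α f‖_{𝕃²(I)} ≤ (C/|λ|) Σ_{j+k ≤ α+2β+1} ‖𝒰^j 𝒳^k g‖_{𝕃²(ℝ)}`. -/
theorem twisted_solution_estimate_on_I (α β : ℕ) :
    ∃ C > 0, ∀ (ν : ℂ) (lam : ℝ), lam ≠ 0 →
      ∀ g : ℝ → ℂ, ContDiffOn ℝ (⊤ : ℕ∞) g {(0 : ℝ)}ᶜ → g 1 = 0 →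
        L2w ((calU ν)^[β] (calX^[α]
            (fun ξ : ℝ => if ξ = 1 then Complex.I / (lam : ℂ) * deriv g 1
              else Complex.I / (lam : ℂ) * g ξ / ((ξ : ℂ) - 1))))
          (Set.Icc (1 / 2 : ℝ) (3 / 2)) ≤
        ENNReal.ofReal (C / |lam|) *
          ∑ j ∈ range (α + 2 * β + 2), ∑ k ∈ range (α + 2 * β + 2 - j),
            L2w ((calU ν)^[j] (calX^[k] g)) Set.univ := by

  obtain ⟨C, hC⟩ := controlled_pow β α
  refine ⟨4 * C + 1, by positivity, fun ν lam hlam g hg hg1 => ?_⟩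
  let G : smoothAway := ⟨g, hg⟩
  let F : smoothAway := ⟨_, contDiffOn_div_sub_one hg hg1⟩
  have hf : (fun ξ : ℝ => if ξ = 1 then Complex.I / (lam : ℂ) * deriv g 1
      else Complex.I / (lam : ℂ) * g ξ / ((ξ : ℂ) - 1)) =
      (((I / lam : ℂ) • F : smoothAway) : ℝ → ℂ) := by
    ext ξ
    simp only [F, Submodule.coe_smul, Pi.smul_apply, smul_eq_mul]
    split_ifs <;> ring
  have hG : (opM - 1) F = G := by
    ext ξ
    simp only [F, G, LinearMap.sub_apply, Module.End.one_apply, Submodule.coe_sub, Pi.sub_apply,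
      opM_apply]
    split_ifs with h
    · simp [h, hg1]
    · have : (ξ : ℂ) - 1 ≠ 0 := sub_ne_zero.2 (by exact_mod_cast h)
      field_simp
  have hsum : sobolevSum ν (α + 2 * β + 2) G ≤ 2 * ∑ j ∈ range (α + 2 * β + 2),
      ∑ k ∈ range (α + 2 * β + 2 - j), L2w ((calU ν)^[j] (calX^[k] g)) Set.univ := by
    simp only [sobolevSum, mul_sum]
    gcongr
    rw [coe_pow_mul_pow]
    exact normI_le_L2w _
  have hnorm : ‖(I / lam : ℂ)‖ₑ = ENNReal.ofReal (1 / |lam|) := by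
    rw [← ofReal_norm]
    simp
  rw [hf, ← coe_pow_mul_pow, map_smul]
  refine (L2w_le_normI _).trans ?_
  rw [Submodule.coe_smul, normI_smul, hnorm]
  have hCF := (hC ν F).trans (mul_le_mul_right (hG ▸ hsum) _)
  refine (mul_le_mul_right (mul_le_mul_right hCF _) _).trans ?_
  have hconst : 2 * (ENNReal.ofReal (1 / |lam|) * (C * 2)) ≤
      ENNReal.ofReal ((4 * C + 1) / |lam|) := by
    rw [show (2 : ENNReal) = ENNReal.ofReal 2 by simp, ← ENNReal.ofReal_coe_nnreal,
      ← ENNReal.ofReal_mul (by positivity), ← ENNReal.ofReal_mul (by positivity),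
      ← ENNReal.ofReal_mul (by positivity)]
    refine ENNReal.ofReal_le_ofReal ?_
    rw [show 2 * (1 / |lam| * ((C : ℝ) * 2)) = 4 * C / |lam| by ring]
    gcongr
    linarith
  refine le_trans (le_of_eq ?_) (mul_le_mul_left hconst _)
  ring
end

section
/- For every α, β ∈ ℕ there is a constant C > 0, depending only on α and β, such that the following holds. Let ν ∈ ℂ, let λ be a nonzero real number, and let g : ℝ∖{0} → ℂ be smooth with g(λ) = 0. Define f(ξ) = i·g(ξ)/(ξ − λ) for ξ ≠ λ, extended smoothly at ξ = λ by f(λ) = i·g′(λ), so that f solves the twisted cohomological equation (𝒱 + iλ)f = g. Then ‖𝒰^β 𝒳^α f‖_{𝕃²(ℝ)} ≤ C·((1 + |λ|^{−β})/|λ|) · Σ_{j+k ≤ α+2β+1, j ≤ β} ‖𝒰^j 𝒳^k g‖_{𝕃²(ℝ)}, provided the right-hand side is finite. -/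
open Complex Finset MeasureTheory

/-- The operator `𝒱 f (ξ) = -i ξ f(ξ)`. -/
noncomputable def calV (f : ℝ → ℂ) : ℝ → ℂ := fun ξ => -Complex.I * (ξ : ℂ) * f ξ

open scoped ContDiff Convolution Topology

/-- Averages of a smooth function over the segments issued from `a` depend smoothly on the other
endpoint. -/
lemma contDiff_integral_segment {h : ℝ → ℂ} (hh : ContDiff ℝ ∞ h) (a : ℝ) :
    ContDiff ℝ ∞ (fun x : ℝ => ∫ t in (0 : ℝ)..1, h (a + t * (x - a))) := by
  let χ : ContDiffBump (0 : ℝ) := ⟨2, 3, by norm_num, by norm_num⟩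
  let k : ℝ → ℝ → ℂ := fun x y => (χ y : ℂ) * h (a + (-y) * (x - a))
  have hk : ContDiff ℝ ∞ (Function.uncurry k) := by
    have h1 : ContDiff ℝ ∞ (fun p : ℝ × ℝ => ((χ p.2 : ℝ) : ℂ)) :=
      Complex.ofRealCLM.contDiff.comp (χ.contDiff.comp contDiff_snd)
    have h2 : ContDiff ℝ ∞ (fun p : ℝ × ℝ => h (a + (-p.2) * (p.1 - a))) :=
      hh.comp (by fun_prop)
    exact h1.mul h2
  have hint : LocallyIntegrable ((Set.Ioc (0 : ℝ) 1).indicator (fun _ => (1 : ℝ))) volume :=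
    ((integrable_indicator_iff measurableSet_Ioc).2 (by simp)).locallyIntegrable
  have key := contDiffOn_convolution_right_with_param (𝕜 := ℝ) (μ := volume) (n := (⊤ : ℕ∞))
    (ContinuousLinearMap.lsmul ℝ ℝ) (g := k) (s := Set.univ)
    (k := Metric.closedBall (0 : ℝ) 3) isOpen_univ (isCompact_closedBall 0 3)
    (fun p x _ hx => by
      have : χ x = 0 := χ.zero_of_le_dist (by
        simpa using (not_le.1 (by simpa [Metric.mem_closedBall] using hx)).le)
      simp [k, this]) hint hk.contDiffOn
  rw [Set.univ_prod_univ, contDiffOn_univ] at key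
  have key2 := key.comp (contDiff_id.prodMk (contDiff_const (c := (0 : ℝ))))
  convert key2 using 1
  ext x
  simp only [Function.comp, MeasureTheory.convolution, id]
  rw [intervalIntegral.integral_of_le zero_le_one, ← integral_indicator measurableSet_Ioc]
  congr 1
  ext t
  by_cases ht : t ∈ Set.Ioc (0 : ℝ) 1
  · have : χ (0 - t) = 1 := χ.one_of_mem_closedBall (by
      simp only [zero_sub, Metric.mem_closedBall, dist_zero_right, norm_neg, Real.norm_eq_abs]
      exact (abs_of_pos ht.1).le.trans (ht.2.trans (by norm_num [χ])))
    simp only [k, ht, Set.indicator_of_mem, this]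
    simp
  · simp [ht]

/-- The divided difference of a smooth function vanishing at `a` is smooth. -/
lemma contDiff_divided_difference {h : ℝ → ℂ} (hh : ContDiff ℝ ∞ h) {a : ℝ} (ha : h a = 0) :
    ContDiff ℝ ∞ (fun x : ℝ => if x = a then deriv h a else h x / ((x : ℂ) - (a : ℂ))) := by
  have hd : ContDiff ℝ ∞ (deriv h) := (contDiff_infty_iff_deriv.1 hh).2
  convert contDiff_integral_segment hd a using 1
  ext x
  split_ifs with hx
  · simp [hx]
  · have hne : (x : ℂ) - (a : ℂ) ≠ 0 := by
      rw [sub_ne_zero]; exact_mod_cast hx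
    have hder : ∀ t ∈ Set.uIcc (0 : ℝ) 1, HasDerivAt (fun t : ℝ => h (a + t * (x - a)))
        ((x - a) • deriv h (a + t * (x - a))) t := fun t _ => by
      have h1 : HasDerivAt (fun t : ℝ => a + t * (x - a)) (x - a) t := by
        simpa using ((hasDerivAt_id t).mul_const (x - a)).const_add a
      exact ((hh.differentiable (by simp) _).hasDerivAt).scomp t h1
    have hcont : Continuous (fun t : ℝ => (x - a) • deriv h (a + t * (x - a))) := by
      have := hd.continuous
      fun_prop
    have := intervalIntegral.integral_eq_sub_of_hasDerivAt hder (hcont.intervalIntegrable 0 1)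
    rw [intervalIntegral.integral_smul] at this
    simp only [one_mul, add_sub_cancel, zero_mul, add_zero, ha, sub_zero] at this
    rw [← this, Complex.real_smul, Complex.ofReal_sub, mul_div_cancel_left₀ _ hne]

/-- The solution of the twisted cohomological equation is smooth away from the origin. -/
lemma contDiffOn_twisted_solution {lam : ℝ} (hlam : lam ≠ 0) {g : ℝ → ℂ}
    (hg : ContDiffOn ℝ ∞ g {(0 : ℝ)}ᶜ) (hg0 : g lam = 0) :
    ContDiffOn ℝ ∞ (fun ξ : ℝ => if ξ = lam then Complex.I * deriv g lam
      else Complex.I * g ξ / ((ξ : ℂ) - (lam : ℂ))) {(0 : ℝ)}ᶜ := by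
  have hat : ∀ x : ℝ, x ≠ 0 → ContDiffAt ℝ ∞ g x := fun x hx =>
    hg.contDiffAt (isOpen_compl_singleton.mem_nhds hx)
  have hpos : 0 < |lam| := abs_pos.2 hlam
  intro x hx
  apply ContDiffAt.contDiffWithinAt
  by_cases hxl : x = lam
  · subst hxl
    let φ : ContDiffBump x := ⟨|x| / 4, |x| / 2, by linarith, by linarith⟩
    let h : ℝ → ℂ := fun y => (φ y : ℂ) * g y
    have hh : ContDiff ℝ ∞ h := by
      rw [contDiff_iff_contDiffAt]
      intro y
      by_cases hy : y = 0
      · subst hy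
        have : h =ᶠ[𝓝 0] fun _ => 0 := by
          filter_upwards [Metric.ball_mem_nhds (0 : ℝ) (show 0 < |x| / 2 by linarith)] with z hz
          have : φ z = 0 := φ.zero_of_le_dist (by
            rw [Metric.mem_ball, dist_zero_right, Real.norm_eq_abs] at hz
            have := abs_sub_abs_le_abs_sub x z
            rw [dist_comm, Real.dist_eq]
            simp only [φ]
            linarith)
          simp [h, this]
        exact contDiffAt_const.congr_of_eventuallyEq this
      · exact (Complex.ofRealCLM.contDiff.comp φ.contDiff).contDiffAt.mul (hat y hy)
    have heq : h =ᶠ[𝓝 x] g := by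
      filter_upwards [φ.eventuallyEq_one] with z hz
      simp only [h, hz]
      simp
    have hd := contDiff_divided_difference hh (heq.eq_of_nhds.trans hg0)
    refine ((contDiff_const (c := Complex.I)).mul hd).contDiffAt.congr_of_eventuallyEq ?_
    filter_upwards [heq] with z hz
    split_ifs
    · rw [heq.deriv_eq]
    · rw [hz, mul_div_assoc]
  · have hne : (x : ℂ) - (lam : ℂ) ≠ 0 := by
      rw [sub_ne_zero]; exact_mod_cast hxl
    have h1 : ContDiffAt ℝ ∞ (fun ξ : ℝ => Complex.I * g ξ / ((ξ : ℂ) - (lam : ℂ))) x := by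
      simp only [div_eq_mul_inv]
      exact (contDiffAt_const.mul (hat x hx)).mul
        ((Complex.ofRealCLM.contDiff.contDiffAt.sub contDiffAt_const).inv hne)
    refine h1.congr_of_eventuallyEq ?_
    filter_upwards [isOpen_compl_singleton.mem_nhds hxl] with z hz
    rw [if_neg (Set.mem_compl_singleton_iff.1 hz)]

/-- The pointwise inequality behind the energy estimate, in real and imaginary parts. -/
lemma pointwise_energy {lam c ξ a b p q : ℝ} (hlam : lam ≠ 0) (hc : 2 ≤ c)
    (hξ : |ξ - lam| ≤ |lam| / 2) :
    (a ^ 2 + b ^ 2) / |ξ| ≤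
      4 / lam ^ 2 * (((-2 * ξ * (ξ - lam) * p - c * lam * a) ^ 2
        + (-2 * ξ * (ξ - lam) * q - c * lam * b) ^ 2) / |ξ|)
      - 4 / |lam| * ((a ^ 2 + b ^ 2) + (ξ - lam) * (2 * (a * p + b * q))) := by
  have hl : 0 < |lam| := abs_pos.2 hlam
  obtain ⟨h1, h2⟩ := abs_le.1 hξ
  have hprod : |ξ| * |lam| = ξ * lam ∧ ξ * lam ≤ 3 / 2 * lam ^ 2 ∧ 0 < |ξ| := by
    rcases lt_or_gt_of_ne hlam with h | h
    · rw [abs_of_neg h] at *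
      rw [abs_of_neg (by linarith : ξ < 0)]
      refine ⟨by ring, by nlinarith, by linarith⟩
    · rw [abs_of_pos h] at *
      rw [abs_of_pos (by linarith : 0 < ξ)]
      refine ⟨by ring, by nlinarith, by linarith⟩
  obtain ⟨h3, h4, h5⟩ := hprod
  have hsq : |lam| ^ 2 = lam ^ 2 := sq_abs lam
  rw [← sub_nonneg]
  set P := -2 * ξ * (ξ - lam) * p - c * lam * a with hP
  set Q := -2 * ξ * (ξ - lam) * q - c * lam * b with hQ
  have hnum : 0 ≤ 4 * (P ^ 2 + Q ^ 2)
      - 4 * (ξ * lam) * ((a ^ 2 + b ^ 2) + (ξ - lam) * (2 * (a * p + b * q)))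
      - lam ^ 2 * (a ^ 2 + b ^ 2) := by
    have : 4 * (P ^ 2 + Q ^ 2)
      - 4 * (ξ * lam) * ((a ^ 2 + b ^ 2) + (ξ - lam) * (2 * (a * p + b * q)))
      - lam ^ 2 * (a ^ 2 + b ^ 2) = (2 * P + lam * a) ^ 2 + (2 * Q + lam * b) ^ 2
        + (4 * (c - 2) * lam ^ 2 + 4 * (3 / 2 * lam ^ 2 - ξ * lam)) * (a ^ 2 + b ^ 2) := by
      rw [hP, hQ]; ring
    rw [this]
    have h6 : 0 ≤ c - 2 := by linarith
    have h7 : 0 ≤ 3 / 2 * lam ^ 2 - ξ * lam := by linarith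
    positivity
  have : 4 / lam ^ 2 * ((P ^ 2 + Q ^ 2) / |ξ|)
      - 4 / |lam| * ((a ^ 2 + b ^ 2) + (ξ - lam) * (2 * (a * p + b * q)))
      - (a ^ 2 + b ^ 2) / |ξ| = (4 * (P ^ 2 + Q ^ 2)
      - 4 * (ξ * lam) * ((a ^ 2 + b ^ 2) + (ξ - lam) * (2 * (a * p + b * q)))
      - lam ^ 2 * (a ^ 2 + b ^ 2)) / (|ξ| * |lam| ^ 2) := by
    rw [← h3, ← hsq]
    field_simp
  rw [this]
  positivity

/-- The energy estimate on the interval of radius `|lam| / 2` around `lam`. -/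
lemma near_energy {lam c : ℝ} (hlam : lam ≠ 0) (hc : 2 ≤ c) {F : ℝ → ℂ}
    (hF : ContDiffOn ℝ ∞ F {(0 : ℝ)}ᶜ) :
    ∫⁻ ξ in Set.Icc (lam - |lam| / 2) (lam + |lam| / 2),
        ENNReal.ofReal (‖F ξ‖ ^ 2) / ENNReal.ofReal |ξ| ≤
      ENNReal.ofReal (4 / lam ^ 2) *
        ∫⁻ ξ in Set.Icc (lam - |lam| / 2) (lam + |lam| / 2),
          ENNReal.ofReal (‖((ξ : ℂ) - lam) * calX F ξ - c * lam * F ξ‖ ^ 2)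
            / ENNReal.ofReal |ξ| := by
  have hl : 0 < |lam| := abs_pos.2 hlam
  set J := Set.Icc (lam - |lam| / 2) (lam + |lam| / 2) with hJ
  have hJabs : ∀ ξ ∈ J, |ξ - lam| ≤ |lam| / 2 := fun ξ hξ =>
    abs_le.2 ⟨by linarith [hξ.1], by linarith [hξ.2]⟩
  have hJ0 : J ⊆ {(0 : ℝ)}ᶜ := by
    rintro ξ hξ rfl
    have := hJabs 0 hξ
    rw [zero_sub, abs_neg] at this
    linarith
  have hpos : ∀ ξ ∈ J, 0 < |ξ| := fun ξ hξ => abs_pos.2 (hJ0 hξ)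
  have hFc : ContinuousOn F J := hF.continuousOn.mono hJ0
  have hF' : ContDiffOn ℝ ∞ (deriv F) {(0 : ℝ)}ᶜ :=
    ((contDiffOn_infty_iff_deriv_of_isOpen isOpen_compl_singleton).1 hF).2
  have hFc' : ContinuousOn (deriv F) J := hF'.continuousOn.mono hJ0
  let H : ℝ → ℂ := fun ξ => ((ξ : ℂ) - lam) * calX F ξ - c * lam * F ξ
  have hHc : ContinuousOn H J := by
    simp only [H, calX]
    fun_prop
  let dφ : ℝ → ℝ := fun ξ => ‖F ξ‖ ^ 2 + (ξ - lam) * (2 * inner ℝ (F ξ) (deriv F ξ))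
  have hdφc : ContinuousOn dφ J := by
    simp only [dφ]
    fun_prop
  have hfrac : ∀ u : ℝ → ℂ, ContinuousOn u J → IntegrableOn (fun ξ => ‖u ξ‖ ^ 2 / |ξ|) J := by
    intro u hu
    refine ContinuousOn.integrableOn_compact isCompact_Icc ?_
    exact (hu.norm.pow 2).div continuous_abs.continuousOn (fun ξ hξ => (hpos ξ hξ).ne')
  have hconv : ∀ u : ℝ → ℂ, ContinuousOn u J →
      ∫⁻ ξ in J, ENNReal.ofReal (‖u ξ‖ ^ 2) / ENNReal.ofReal |ξ|
        = ENNReal.ofReal (∫ ξ in J, ‖u ξ‖ ^ 2 / |ξ|) := by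
    intro u hu
    rw [ofReal_integral_eq_lintegral_ofReal (hfrac u hu)
      (Filter.Eventually.of_forall fun ξ => by positivity)]
    refine setLIntegral_congr_fun measurableSet_Icc fun ξ hξ => ?_
    exact (ENNReal.ofReal_div_of_pos (hpos ξ hξ)).symm
  have hdφi : IntegrableOn dφ J := hdφc.integrableOn_compact isCompact_Icc
  rw [hconv F hFc, hconv H hHc, ← ENNReal.ofReal_mul (by positivity)]
  apply ENNReal.ofReal_le_ofReal
  have hφ : 0 ≤ ∫ ξ in J, dφ ξ := by
    have hle : lam - |lam| / 2 ≤ lam + |lam| / 2 := by linarith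
    rw [hJ, integral_Icc_eq_integral_Ioc, ← intervalIntegral.integral_of_le hle]
    have hder : ∀ ξ ∈ Set.uIcc (lam - |lam| / 2) (lam + |lam| / 2),
        HasDerivAt (fun ξ => (ξ - lam) * ‖F ξ‖ ^ 2) (dφ ξ) ξ := by
      intro ξ hξ
      rw [Set.uIcc_of_le hle] at hξ
      have hd : HasDerivAt F (deriv F ξ) ξ :=
        ((hF.contDiffAt (isOpen_compl_singleton.mem_nhds (hJ0 hξ))).differentiableAt
          (by simp)).hasDerivAt
      have := ((hasDerivAt_id ξ).sub_const lam).mul hd.norm_sq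
      exact this.congr_deriv (by simp [dφ])
    rw [intervalIntegral.integral_eq_sub_of_hasDerivAt hder
      ((hdφc.mono (Set.uIcc_of_le hle).subset).intervalIntegrable)]
    have h1 := sq_nonneg ‖F (lam + |lam| / 2)‖
    have h2 := sq_nonneg ‖F (lam - |lam| / 2)‖
    ring_nf at h1 h2 ⊢
    positivity
  have hmono : ∫ ξ in J, ‖F ξ‖ ^ 2 / |ξ| ≤
      ∫ ξ in J, (4 / lam ^ 2 * (‖H ξ‖ ^ 2 / |ξ|) - 4 / |lam| * dφ ξ) := by
    refine setIntegral_mono_on (hfrac F hFc)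
      (((hfrac H hHc).const_mul _).sub (hdφi.const_mul _)) measurableSet_Icc fun ξ hξ => ?_
    have := pointwise_energy (a := (F ξ).re) (b := (F ξ).im) (p := (deriv F ξ).re)
      (q := (deriv F ξ).im) hlam hc (hJabs ξ hξ)
    have hn : ‖F ξ‖ ^ 2 = (F ξ).re ^ 2 + (F ξ).im ^ 2 := by
      rw [← Complex.normSq_eq_norm_sq, Complex.normSq_apply]; ring
    have hi : inner ℝ (F ξ) (deriv F ξ)
        = (F ξ).re * (deriv F ξ).re + (F ξ).im * (deriv F ξ).im := by
      rw [Complex.inner]; simp; ring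
    have hH : ‖H ξ‖ ^ 2 = (-2 * ξ * (ξ - lam) * (deriv F ξ).re - c * lam * (F ξ).re) ^ 2
        + (-2 * ξ * (ξ - lam) * (deriv F ξ).im - c * lam * (F ξ).im) ^ 2 := by
      rw [← Complex.normSq_eq_norm_sq, Complex.normSq_apply]
      simp [H, calX]
      ring
    simp only [dφ]
    rw [hn, hi, hH]
    exact this
  refine hmono.trans ?_
  rw [integral_sub ((hfrac H hHc).const_mul _) (hdφi.const_mul _), integral_const_mul,
    integral_const_mul]
  have : 0 ≤ 4 / |lam| * ∫ ξ in J, dφ ξ := by positivity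
  linarith

/-- The basic coercivity estimate: an energy inequality near `lam`, division away from it. -/
lemma L2w_le_of_twisted {lam c : ℝ} (hlam : lam ≠ 0) (hc : 2 ≤ c) {F : ℝ → ℂ}
    (hF : ContDiffOn ℝ ∞ F {(0 : ℝ)}ᶜ) :
    L2w F Set.univ ≤ ENNReal.ofReal (2 / |lam|) *
      (L2w (fun ξ => ((ξ : ℂ) - lam) * calX F ξ - c * lam * F ξ) Set.univ
        + L2w (fun ξ => ((ξ : ℂ) - lam) * F ξ) Set.univ) := by
  have hl : 0 < |lam| := abs_pos.2 hlam
  have hK : ENNReal.ofReal (4 / lam ^ 2) ^ (1 / 2 : ℝ) = ENNReal.ofReal (2 / |lam|) := by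
    rw [ENNReal.ofReal_rpow_of_nonneg (by positivity) (by norm_num), ← Real.sqrt_eq_rpow]
    congr 1
    rw [show 4 / lam ^ 2 = (2 / |lam|) ^ 2 by rw [div_pow, sq_abs]; norm_num,
      Real.sqrt_sq (by positivity)]
  set J := Set.Icc (lam - |lam| / 2) (lam + |lam| / 2) with hJ
  have hfar : ∫⁻ ξ in Jᶜ, ENNReal.ofReal (‖F ξ‖ ^ 2) / ENNReal.ofReal |ξ| ≤
      ENNReal.ofReal (4 / lam ^ 2) *
        ∫⁻ ξ : ℝ, ENNReal.ofReal (‖((ξ : ℂ) - lam) * F ξ‖ ^ 2) / ENNReal.ofReal |ξ| := by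
    rw [← lintegral_const_mul' _ _ ENNReal.ofReal_ne_top]
    refine (setLIntegral_mono' measurableSet_Icc.compl fun ξ hξ => ?_).trans
      (setLIntegral_le_lintegral _ _)
    rw [← mul_div_assoc, ← ENNReal.ofReal_mul (by positivity)]
    refine ENNReal.div_le_div_right (ENNReal.ofReal_le_ofReal ?_) _
    have h1 : |lam| / 2 ≤ |ξ - lam| := by
      by_contra hcon
      obtain ⟨h2, h3⟩ := abs_lt.1 (not_le.1 hcon)
      exact hξ ⟨by linarith, by linarith⟩
    have h2 : ‖(ξ : ℂ) - lam‖ = |ξ - lam| := by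
      rw [← Complex.ofReal_sub, Complex.norm_real, Real.norm_eq_abs]
    rw [norm_mul, mul_pow, h2, ← mul_assoc]
    have h3 : 1 ≤ 4 / lam ^ 2 * |ξ - lam| ^ 2 := by
      rw [← sq_abs lam, div_mul_eq_mul_div, one_le_div (by positivity)]
      nlinarith
    nlinarith [sq_nonneg ‖F ξ‖]
  have hsum : ∫⁻ ξ : ℝ, ENNReal.ofReal (‖F ξ‖ ^ 2) / ENNReal.ofReal |ξ| ≤
      ENNReal.ofReal (4 / lam ^ 2) *
        ((∫⁻ ξ : ℝ, ENNReal.ofReal (‖((ξ : ℂ) - lam) * calX F ξ - c * lam * F ξ‖ ^ 2)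
            / ENNReal.ofReal |ξ|)
          + ∫⁻ ξ : ℝ, ENNReal.ofReal (‖((ξ : ℂ) - lam) * F ξ‖ ^ 2) / ENNReal.ofReal |ξ|) := by
    rw [← lintegral_add_compl _ (measurableSet_Icc : MeasurableSet J), mul_add]
    refine add_le_add ((near_energy hlam hc hF).trans ?_) hfar
    exact mul_le_mul_right (setLIntegral_le_lintegral _ _) _
  simp only [L2w, Measure.restrict_univ]
  rw [← hK]
  refine (ENNReal.rpow_le_rpow hsum (by norm_num)).trans ?_
  rw [ENNReal.mul_rpow_of_nonneg _ _ (by norm_num)]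
  gcongr
  exact ENNReal.rpow_add_le_add_rpow _ _ (by norm_num) (by norm_num)

/-- The space of functions on the line that are smooth away from the origin. -/
def smoothOff : Submodule ℂ (ℝ → ℂ) where
  carrier := {f | ContDiffOn ℝ ∞ f {(0 : ℝ)}ᶜ}
  add_mem' hf hg := ContDiffOn.add hf hg
  zero_mem' := contDiffOn_const
  smul_mem' c _ hf := ContDiffOn.const_smul c hf

namespace smoothOff

lemma contDiffOn_deriv {f : ℝ → ℂ} (hf : ContDiffOn ℝ ∞ f {(0 : ℝ)}ᶜ) :
    ContDiffOn ℝ ∞ (deriv f) {(0 : ℝ)}ᶜ :=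
  ((contDiffOn_infty_iff_deriv_of_isOpen isOpen_compl_singleton).1 hf).2

lemma differentiableAt {f : ℝ → ℂ} (hf : ContDiffOn ℝ ∞ f {(0 : ℝ)}ᶜ) {x : ℝ} (hx : x ≠ 0) :
    DifferentiableAt ℝ f x :=
  (hf.contDiffAt (isOpen_compl_singleton.mem_nhds hx)).differentiableAt (by simp)

lemma contDiffOn_ofReal {s : Set ℝ} : ContDiffOn ℝ ∞ (fun x : ℝ => (x : ℂ)) s :=
  Complex.ofRealCLM.contDiff.contDiffOn

lemma eventually_ne {x : ℝ} (hx : x ≠ 0) : ∀ᶠ y in 𝓝 x, y ≠ 0 :=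
  isOpen_compl_singleton.mem_nhds hx

/-- `calX` as an endomorphism of `smoothOff`. -/
noncomputable def opX : Module.End ℂ smoothOff where
  toFun f := ⟨calX f, (contDiffOn_const.mul contDiffOn_ofReal).mul (contDiffOn_deriv f.2)⟩
  map_add' f g := by
    ext x
    by_cases hx : x = 0
    · simp [calX, hx]
    · change -2 * (x : ℂ) * deriv ((f : ℝ → ℂ) + (g : ℝ → ℂ)) x
        = -2 * (x : ℂ) * deriv f x + -2 * (x : ℂ) * deriv g x
      rw [deriv_add (differentiableAt f.2 hx) (differentiableAt g.2 hx)]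
      ring
  map_smul' c f := by
    ext x
    by_cases hx : x = 0
    · simp [calX, hx]
    · change -2 * (x : ℂ) * deriv (c • (f : ℝ → ℂ)) x = c * (-2 * (x : ℂ) * deriv f x)
      rw [deriv_const_smul c (differentiableAt f.2 hx), smul_eq_mul]
      ring

/-- `calU ν` as an endomorphism of `smoothOff`. -/
noncomputable def opU (ν : ℂ) : Module.End ℂ smoothOff where
  toFun f := ⟨calU ν f, by
    have h : ContDiffOn ℝ ∞ (fun x : ℝ => (ν ^ 2 - 1) / (4 * (x : ℂ))) {(0 : ℝ)}ᶜ := by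
      simp only [div_eq_mul_inv]
      refine contDiffOn_const.mul ((contDiffOn_const.mul contDiffOn_ofReal).inv fun x hx => ?_)
      simpa using hx
    exact contDiffOn_const.mul ((h.mul f.2).sub
      (contDiffOn_ofReal.mul (contDiffOn_deriv (contDiffOn_deriv f.2))))⟩
  map_add' f g := by
    ext x
    by_cases hx : x = 0
    · simp [calU, hx]
    · have h1 : deriv ((f : ℝ → ℂ) + (g : ℝ → ℂ)) =ᶠ[𝓝 x] deriv f + deriv g := by
        filter_upwards [eventually_ne hx] with y hy
        exact deriv_add (differentiableAt f.2 hy) (differentiableAt g.2 hy)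
      have h2 : deriv (deriv ((f : ℝ → ℂ) + (g : ℝ → ℂ))) x
          = deriv (deriv f) x + deriv (deriv g) x := by
        rw [h1.deriv_eq, deriv_add (differentiableAt (contDiffOn_deriv f.2) hx)
          (differentiableAt (contDiffOn_deriv g.2) hx)]
      simp only [calU, Submodule.coe_add, Pi.add_apply, h2]
      ring
  map_smul' c f := by
    ext x
    by_cases hx : x = 0
    · simp [calU, hx]
    · have h1 : deriv (c • (f : ℝ → ℂ)) =ᶠ[𝓝 x] c • deriv f := by
        filter_upwards [eventually_ne hx] with y hy
        exact deriv_const_smul c (differentiableAt f.2 hy)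
      have h2 : deriv (deriv (c • (f : ℝ → ℂ))) x = c * deriv (deriv f) x := by
        rw [h1.deriv_eq, deriv_const_smul c (differentiableAt (contDiffOn_deriv f.2) hx),
          smul_eq_mul]
      simp only [calU, Submodule.coe_smul, Pi.smul_apply, h2, smul_eq_mul, RingHom.id_apply]
      ring

/-- Multiplication by `ξ - lam` as an endomorphism of `smoothOff`. -/
noncomputable def opM (lam : ℝ) : Module.End ℂ smoothOff where
  toFun f := ⟨fun x => ((x : ℂ) - lam) * (f : ℝ → ℂ) x,
    (contDiffOn_ofReal.sub contDiffOn_const).mul f.2⟩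
  map_add' f g := by
    ext x
    simp [mul_add]
  map_smul' c f := by
    ext x
    simp only [Submodule.coe_smul, Pi.smul_apply, smul_eq_mul, RingHom.id_apply]
    ring

lemma opX_apply (f : smoothOff) (x : ℝ) :
    (opX f : ℝ → ℂ) x = -2 * (x : ℂ) * deriv f x := rfl

lemma opM_apply (lam : ℝ) (f : smoothOff) (x : ℝ) :
    (opM lam f : ℝ → ℂ) x = ((x : ℂ) - lam) * (f : ℝ → ℂ) x := rfl

lemma opU_apply (ν : ℂ) (f : smoothOff) (x : ℝ) :
    (opU ν f : ℝ → ℂ) x = Complex.I * ((ν ^ 2 - 1) / (4 * (x : ℂ)) * (f : ℝ → ℂ) x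
      - (x : ℂ) * deriv (deriv f) x) := rfl

lemma coe_opX_pow (n : ℕ) (f : smoothOff) : ((opX ^ n) f : ℝ → ℂ) = calX^[n] f := by
  induction n with
  | zero => rfl
  | succ n ih =>
    rw [pow_succ', Function.iterate_succ_apply', ← ih]
    rfl

lemma coe_opU_pow (ν : ℂ) (n : ℕ) (f : smoothOff) :
    ((opU ν ^ n) f : ℝ → ℂ) = (calU ν)^[n] f := by
  induction n with
  | zero => rfl
  | succ n ih =>
    rw [pow_succ', Function.iterate_succ_apply', ← ih]
    rfl

lemma hasDerivAt (f : smoothOff) {x : ℝ} (hx : x ≠ 0) :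
    HasDerivAt (f : ℝ → ℂ) (deriv f x) x :=
  (differentiableAt f.2 hx).hasDerivAt

lemma hasDerivAt_deriv (f : smoothOff) {x : ℝ} (hx : x ≠ 0) :
    HasDerivAt (deriv (f : ℝ → ℂ)) (deriv (deriv f) x) x :=
  (differentiableAt (contDiffOn_deriv f.2) hx).hasDerivAt

lemma hasDerivAt_deriv_deriv (f : smoothOff) {x : ℝ} (hx : x ≠ 0) :
    HasDerivAt (deriv (deriv (f : ℝ → ℂ))) (deriv (deriv (deriv f)) x) x :=
  (differentiableAt (contDiffOn_deriv (contDiffOn_deriv f.2)) hx).hasDerivAt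

lemma hasDerivAt_ofReal (x : ℝ) : HasDerivAt (fun x : ℝ => (x : ℂ)) 1 x :=
  Complex.ofRealCLM.hasDerivAt

lemma deriv_opM (lam : ℝ) (f : smoothOff) {x : ℝ} (hx : x ≠ 0) :
    deriv (opM lam f : ℝ → ℂ) x = (f : ℝ → ℂ) x + ((x : ℂ) - lam) * deriv f x := by
  have := ((hasDerivAt_ofReal x).sub_const (lam : ℂ)).mul (hasDerivAt f hx)
  rw [one_mul] at this
  exact this.deriv

lemma deriv_deriv_opM (lam : ℝ) (f : smoothOff) {x : ℝ} (hx : x ≠ 0) :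
    deriv (deriv (opM lam f : ℝ → ℂ)) x
      = 2 * deriv f x + ((x : ℂ) - lam) * deriv (deriv f) x := by
  have h1 : deriv (opM lam f : ℝ → ℂ)
      =ᶠ[𝓝 x] fun y => (f : ℝ → ℂ) y + ((y : ℂ) - lam) * deriv f y := by
    filter_upwards [eventually_ne hx] with y hy using deriv_opM lam f hy
  have h2 := (hasDerivAt f hx).add
    (((hasDerivAt_ofReal x).sub_const (lam : ℂ)).mul (hasDerivAt_deriv f hx))
  rw [h1.deriv_eq]
  refine h2.deriv.trans ?_
  ring

lemma deriv_opX (f : smoothOff) {x : ℝ} (hx : x ≠ 0) :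
    deriv (opX f : ℝ → ℂ) x = -2 * deriv f x - 2 * (x : ℂ) * deriv (deriv f) x := by
  have := ((hasDerivAt_ofReal x).const_mul (-2 : ℂ)).mul (hasDerivAt_deriv f hx)
  refine this.deriv.trans ?_
  ring

lemma deriv_deriv_opX (f : smoothOff) {x : ℝ} (hx : x ≠ 0) :
    deriv (deriv (opX f : ℝ → ℂ)) x
      = -4 * deriv (deriv f) x - 2 * (x : ℂ) * deriv (deriv (deriv f)) x := by
  have h1 : deriv (opX f : ℝ → ℂ)
      =ᶠ[𝓝 x] fun y => -2 * deriv f y - 2 * (y : ℂ) * deriv (deriv f) y := by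
    filter_upwards [eventually_ne hx] with y hy using deriv_opX f hy
  have h2 := ((hasDerivAt_deriv f hx).const_mul (-2 : ℂ)).sub
    (((hasDerivAt_ofReal x).const_mul (2 : ℂ)).mul (hasDerivAt_deriv_deriv f hx))
  rw [h1.deriv_eq]
  refine h2.deriv.trans ?_
  ring

lemma deriv_opU (ν : ℂ) (f : smoothOff) {x : ℝ} (hx : x ≠ 0) :
    deriv (opU ν f : ℝ → ℂ) x = Complex.I * (-(ν ^ 2 - 1) / (4 * (x : ℂ) ^ 2) * (f : ℝ → ℂ) x
      + (ν ^ 2 - 1) / (4 * (x : ℂ)) * deriv f x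
      - deriv (deriv f) x - (x : ℂ) * deriv (deriv (deriv f)) x) := by
  have hx' : (x : ℂ) ≠ 0 := by exact_mod_cast hx
  have h0 := (hasDerivAt_const x (ν ^ 2 - 1)).div ((hasDerivAt_ofReal x).const_mul (4 : ℂ))
    (by simpa using hx')
  have h2 := ((h0.mul (hasDerivAt f hx)).sub
    ((hasDerivAt_ofReal x).mul (hasDerivAt_deriv_deriv f hx))).const_mul Complex.I
  refine h2.deriv.trans ?_
  simp only [Pi.div_apply]
  field_simp
  ring

lemma opX_opM (lam : ℝ) (f : smoothOff) :
    opX (opM lam f) = opM lam (opX f) - (2 : ℂ) • opM lam f - (2 * lam : ℂ) • f := by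
  ext x
  simp only [Submodule.coe_sub, Submodule.coe_smul, Pi.sub_apply, Pi.smul_apply, smul_eq_mul]
  by_cases hx : x = 0
  · simp [opX_apply, opM_apply, hx]
    ring
  · rw [opX_apply, opM_apply, opM_apply, opX_apply, deriv_opM lam f hx]
    ring

lemma opX_opU (ν : ℂ) (f : smoothOff) : opX (opU ν f) = opU ν (opX f) + (2 : ℂ) • opU ν f := by
  ext x
  simp only [Submodule.coe_add, Submodule.coe_smul, Pi.add_apply, Pi.smul_apply, smul_eq_mul]
  by_cases hx : x = 0
  · simp [opX_apply, opU_apply, hx]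
  · have hx' : (x : ℂ) ≠ 0 := by exact_mod_cast hx
    rw [opX_apply, opU_apply, opU_apply, opX_apply, deriv_opU ν f hx, deriv_deriv_opX f hx]
    field_simp
    ring

lemma opM_opU (lam : ℝ) (ν : ℂ) (f : smoothOff) :
    opM lam (opU ν f) = opU ν (opM lam f) - Complex.I • opX f := by
  ext x
  simp only [Submodule.coe_sub, Submodule.coe_smul, Pi.sub_apply, Pi.smul_apply, smul_eq_mul]
  by_cases hx : x = 0
  · simp [opX_apply, opU_apply, opM_apply, hx]
  · rw [opX_apply, opU_apply, opM_apply, opU_apply, opM_apply, deriv_deriv_opM lam f hx]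
    ring

end smoothOff

namespace smoothOff

/-- The norm of `L²(ℝ, |ξ|⁻¹ dξ)` on `smoothOff`. -/
noncomputable def wnorm (f : smoothOff) : ENNReal := L2w f Set.univ

lemma aemeasurable (f : smoothOff) : AEMeasurable (f : ℝ → ℂ) volume := by
  have h : AEMeasurable (f : ℝ → ℂ) (volume.restrict {(0 : ℝ)}ᶜ) :=
    (ContDiffOn.continuousOn f.2).aemeasurable (measurableSet_singleton 0).compl
  rwa [restrict_compl_singleton] at h

lemma wnorm_eq_eLpNorm (f : smoothOff) :
    wnorm f = eLpNorm (f : ℝ → ℂ) 2 (volume.withDensity fun ξ : ℝ => (ENNReal.ofReal |ξ|)⁻¹) := by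
  have hd : Measurable fun ξ : ℝ => (ENNReal.ofReal |ξ|)⁻¹ :=
    (ENNReal.measurable_ofReal.comp measurable_abs).inv
  rw [eLpNorm_eq_lintegral_rpow_enorm_toReal (by norm_num) (by norm_num), wnorm, L2w,
    Measure.restrict_univ,
    lintegral_withDensity_eq_lintegral_mul₀ hd.aemeasurable
      ((aemeasurable f).enorm.pow_const _)]
  simp only [ENNReal.toReal_ofNat]
  congr 2
  ext ξ
  rw [Pi.mul_apply, div_eq_mul_inv, mul_comm, ← ofReal_norm,
    ENNReal.ofReal_rpow_of_nonneg (norm_nonneg _) (by norm_num), Real.rpow_two]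

lemma wnorm_add_le (f g : smoothOff) : wnorm (f + g) ≤ wnorm f + wnorm g := by
  simp only [wnorm_eq_eLpNorm]
  exact eLpNorm_add_le
    ((aemeasurable f).mono_ac (withDensity_absolutelyContinuous _ _)).aestronglyMeasurable
    ((aemeasurable g).mono_ac (withDensity_absolutelyContinuous _ _)).aestronglyMeasurable
    (by norm_num)

lemma wnorm_smul (c : ℂ) (f : smoothOff) : wnorm (c • f) = ‖c‖ₑ * wnorm f := by
  simp only [wnorm_eq_eLpNorm]
  exact eLpNorm_const_smul c _ _ _

/-- The sum of the norms of the first `n` iterates of `calX`. -/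
noncomputable def wsum (n : ℕ) (f : smoothOff) : ENNReal :=
  ∑ k ∈ range n, wnorm ((opX ^ k) f)

lemma wsum_add_le (n : ℕ) (f g : smoothOff) : wsum n (f + g) ≤ wsum n f + wsum n g := by
  simp only [wsum, ← sum_add_distrib, map_add]
  exact sum_le_sum fun k _ => wnorm_add_le _ _

lemma wsum_smul (n : ℕ) (c : ℂ) (f : smoothOff) : wsum n (c • f) = ‖c‖ₑ * wsum n f := by
  simp only [wsum, map_smul, wnorm_smul, mul_sum]

lemma wsum_mono {m n : ℕ} (h : m ≤ n) (f : smoothOff) : wsum m f ≤ wsum n f :=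
  sum_le_sum_of_subset (range_mono h)

lemma wsum_opX_le (n : ℕ) (f : smoothOff) : wsum n (opX f) ≤ wsum (n + 1) f := by
  simp only [wsum]
  rw [sum_range_succ']
  exact le_self_add

lemma wnorm_le_wsum {k n : ℕ} (h : k < n) (f : smoothOff) : wnorm ((opX ^ k) f) ≤ wsum n f :=
  single_le_sum (f := fun k => wnorm ((opX ^ k) f)) (fun _ _ => zero_le) (mem_range.2 h)

/-- The defect `M Xᵃ⁺¹ - 2 (a + 1) lam Xᵃ`, which involves `f` only through lower iterates. -/
noncomputable def opH (lam : ℝ) (a : ℕ) : Module.End ℂ smoothOff :=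
  opM lam * opX ^ (a + 1) - (2 * (a + 1) * lam : ℂ) • opX ^ a

lemma opH_apply (lam : ℝ) (a : ℕ) (f : smoothOff) : opH lam a f
    = opM lam (opX ((opX ^ a) f)) - (2 * (a + 1) * lam : ℂ) • (opX ^ a) f := by
  rw [opH, pow_succ']
  rfl

lemma opH_zero (lam : ℝ) (f : smoothOff) :
    opH lam 0 f = opX (opM lam f) + (2 : ℂ) • opM lam f := by
  rw [opX_opM, opH_apply]
  simp only [pow_zero, Module.End.one_apply, Nat.cast_zero]
  module

lemma opH_succ (lam : ℝ) (a : ℕ) (f : smoothOff) : opH lam (a + 1) f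
    = opX (opH lam a f) + (2 : ℂ) • opH lam a f + (4 * (a + 1) * lam : ℂ) • (opX ^ a) f := by
  simp only [opH_apply, map_sub, map_smul, opX_opM, pow_succ', Module.End.mul_apply]
  push_cast
  module

lemma wnorm_opH_le (a : ℕ) : ∃ C : NNReal, ∀ (lam : ℝ) (f : smoothOff) (n : ℕ),
    wnorm ((opX ^ n) (opH lam a f)) ≤
      C * (wsum (a + n + 2) (opM lam f) + ‖(lam : ℂ)‖ₑ * wsum (a + n) f) := by
  induction a with
  | zero =>
    refine ⟨1 + ‖(2 : ℂ)‖₊, fun lam f n => ?_⟩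
    have h : (opX ^ n) (opH lam 0 f)
        = (opX ^ (n + 1)) (opM lam f) + (2 : ℂ) • (opX ^ n) (opM lam f) := by
      rw [opH_zero, pow_succ]
      simp
    rw [h]
    refine (wnorm_add_le _ _).trans ?_
    rw [wnorm_smul]
    have h1 : wnorm ((opX ^ (n + 1)) (opM lam f)) ≤ wsum (0 + n + 2) (opM lam f) :=
      wnorm_le_wsum (by omega) _
    have h2 : wnorm ((opX ^ n) (opM lam f)) ≤ wsum (0 + n + 2) (opM lam f) :=
      wnorm_le_wsum (by omega) _
    calc _ ≤ wsum (0 + n + 2) (opM lam f) + ‖(2 : ℂ)‖ₑ * wsum (0 + n + 2) (opM lam f) := by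
          gcongr
      _ = ((1 + ‖(2 : ℂ)‖₊ : NNReal) : ENNReal) * wsum (0 + n + 2) (opM lam f) := by
          push_cast
          rw [add_mul, one_mul]
          rfl
      _ ≤ _ := by gcongr; exact le_self_add
  | succ a ih =>
    obtain ⟨C, hC⟩ := ih
    refine ⟨C + ‖(2 : ℂ)‖₊ * C + ‖(4 * (a + 1) : ℂ)‖₊, fun lam f n => ?_⟩
    have h : (opX ^ n) (opH lam (a + 1) f) = (opX ^ (n + 1)) (opH lam a f)
        + (2 : ℂ) • (opX ^ n) (opH lam a f)
        + (4 * (a + 1) * lam : ℂ) • (opX ^ (a + n)) f := by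
      rw [opH_succ, pow_succ, add_comm a n, pow_add]
      simp
    rw [h]
    refine (wnorm_add_le _ _).trans ((add_le_add_left (wnorm_add_le _ _) _).trans ?_)
    rw [wnorm_smul, wnorm_smul, enorm_mul (4 * (a + 1) : ℂ)]
    set S := wsum (a + 1 + n + 2) (opM lam f) + ‖(lam : ℂ)‖ₑ * wsum (a + 1 + n) f with hS
    have h1 : wnorm ((opX ^ (n + 1)) (opH lam a f)) ≤ C * S := by
      refine (hC lam f (n + 1)).trans_eq ?_
      rw [hS, show a + (n + 1) = a + 1 + n by omega]
    have h2 : wnorm ((opX ^ n) (opH lam a f)) ≤ C * S := by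
      refine (hC lam f n).trans ?_
      gcongr
      rw [hS]
      gcongr
      · exact wsum_mono (by omega) _
      · exact wsum_mono (by omega) _
    have h3 : ‖(lam : ℂ)‖ₑ * wnorm ((opX ^ (a + n)) f) ≤ S := by
      refine le_trans ?_ le_add_self
      gcongr
      exact wnorm_le_wsum (by omega) _
    calc _ ≤ C * S + ‖(2 : ℂ)‖ₑ * (C * S) + ‖(4 * (a + 1) : ℂ)‖ₑ * S := by
          rw [mul_assoc ‖(4 * (a + 1) : ℂ)‖ₑ]
          gcongr
      _ = _ := by
          push_cast
          simp only [enorm_eq_nnnorm]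
          ring

lemma enorm_mul_wnorm_le {lam : ℝ} (hlam : lam ≠ 0) (a : ℕ) (f : smoothOff) :
    ‖(lam : ℂ)‖ₑ * wnorm ((opX ^ a) f) ≤
      2 * (wnorm (opH lam a f) + wnorm (opM lam ((opX ^ a) f))) := by
  have hc : (2 : ℝ) ≤ 2 * (a + 1) := by
    have : (0 : ℝ) ≤ a := a.cast_nonneg
    linarith
  have key := L2w_le_of_twisted hlam hc ((opX ^ a) f).2
  have hH : (fun ξ : ℝ => ((ξ : ℂ) - lam) * calX ((opX ^ a) f : smoothOff) ξ
      - (2 * (a + 1) : ℝ) * lam * ((opX ^ a) f : ℝ → ℂ) ξ) = (opH lam a f : ℝ → ℂ) := by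
    rw [opH, pow_succ']
    ext ξ
    simp [opM_apply, opX_apply, calX]
  rw [hH] at key
  have hl : ‖(lam : ℂ)‖ₑ = ENNReal.ofReal |lam| := by
    rw [← ofReal_norm, Complex.norm_real, Real.norm_eq_abs]
  have hl0 : 0 < |lam| := abs_pos.2 hlam
  calc _ ≤ ENNReal.ofReal |lam| * (ENNReal.ofReal (2 / |lam|) *
        (wnorm (opH lam a f) + wnorm (opM lam ((opX ^ a) f)))) := by
        rw [hl]
        exact mul_le_mul_right key _
    _ = _ := by
        rw [← mul_assoc, ← ENNReal.ofReal_mul hl0.le, mul_div_cancel₀ _ hl0.ne']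
        simp

lemma wnorm_opM_opX_le (a : ℕ) : ∃ C : NNReal, ∀ (lam : ℝ) (f : smoothOff),
    wnorm (opM lam ((opX ^ a) f)) ≤
      C * (wsum (a + 1) (opM lam f) + ‖(lam : ℂ)‖ₑ * wsum a f) := by
  cases a with
  | zero =>
    refine ⟨1, fun lam f => ?_⟩
    simp [wsum]
  | succ a =>
    obtain ⟨C, hC⟩ := wnorm_opH_le a
    refine ⟨C + ‖(2 * (a + 1) : ℂ)‖₊, fun lam f => ?_⟩
    have h : opM lam ((opX ^ (a + 1)) f)
        = opH lam a f + (2 * (a + 1) * lam : ℂ) • (opX ^ a) f := by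
      simp [opH]
    rw [h]
    refine (wnorm_add_le _ _).trans ?_
    rw [wnorm_smul, enorm_mul (2 * (a + 1) : ℂ), mul_assoc]
    have h1 := hC lam f 0
    rw [pow_zero, Module.End.one_apply, add_zero] at h1
    set S := wsum (a + 1 + 1) (opM lam f) + ‖(lam : ℂ)‖ₑ * wsum (a + 1) f with hS
    have h2 : wnorm (opH lam a f) ≤ C * S := by
      refine h1.trans ?_
      rw [hS]
      gcongr
      exact wsum_mono (by omega) _
    have h3 : ‖(lam : ℂ)‖ₑ * wnorm ((opX ^ a) f) ≤ S := by
      refine le_trans ?_ le_add_self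
      gcongr
      exact wnorm_le_wsum (by omega) _
    calc _ ≤ C * S + ‖(2 * (a + 1) : ℂ)‖ₑ * S := by gcongr
      _ = _ := by
          push_cast
          simp only [enorm_eq_nnnorm]
          ring

/-- Division by `ξ - lam` costs one iterate of `calX` and gains a factor `|lam|⁻¹`. -/
lemma enorm_mul_wsum_le (n : ℕ) : ∃ C : NNReal, ∀ (lam : ℝ), lam ≠ 0 → ∀ f : smoothOff,
    ‖(lam : ℂ)‖ₑ * wsum n f ≤ C * wsum (n + 1) (opM lam f) := by
  induction n with
  | zero => exact ⟨0, fun lam _ f => by simp [wsum]⟩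
  | succ n ih =>
    obtain ⟨C, hC⟩ := ih
    obtain ⟨C₁, hC₁⟩ := wnorm_opH_le n
    obtain ⟨C₂, hC₂⟩ := wnorm_opM_opX_le n
    refine ⟨C + 2 * (C₁ * (1 + C) + C₂ * (1 + C)), fun lam hlam f => ?_⟩
    set S := wsum (n + 1 + 1) (opM lam f) with hS
    have h0 : ‖(lam : ℂ)‖ₑ * wsum n f ≤ C * S :=
      (hC lam hlam f).trans (by rw [hS]; gcongr; exact wsum_mono (by omega) _)
    have h1 : wnorm (opH lam n f) ≤ C₁ * (S + C * S) := by
      have := hC₁ lam f 0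
      rw [pow_zero, Module.End.one_apply, add_zero] at this
      exact this.trans (by gcongr)
    have h2 : wnorm (opM lam ((opX ^ n) f)) ≤ C₂ * (S + C * S) :=
      (hC₂ lam f).trans (by gcongr; exact wsum_mono (by omega) _)
    rw [wsum, sum_range_succ, mul_add]
    calc _ ≤ C * S + 2 * (C₁ * (S + C * S) + C₂ * (S + C * S)) :=
          add_le_add h0 ((enorm_mul_wnorm_le hlam n f).trans (by gcongr))
      _ = _ := by
          push_cast
          ring

lemma wnorm_add_smul_pow_le (c : ℂ) (k : ℕ) : ∃ C : NNReal,
    ∀ (P Y : Module.End ℂ smoothOff) (f : smoothOff),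
      wnorm (P (((Y + c • 1) ^ k) f)) ≤ C * ∑ m ∈ range (k + 1), wnorm (P ((Y ^ m) f)) := by
  induction k with
  | zero => exact ⟨1, fun P Y f => by simp⟩
  | succ k ih =>
    obtain ⟨C, hC⟩ := ih
    refine ⟨C + ‖c‖₊ * C, fun P Y f => ?_⟩
    have h : P (((Y + c • 1) ^ (k + 1)) f)
        = P (((Y + c • 1) ^ k) (Y f)) + c • P (((Y + c • 1) ^ k) f) := by
      rw [pow_succ]
      simp
    rw [h]
    refine (wnorm_add_le _ _).trans ?_
    rw [wnorm_smul]
    set S := ∑ m ∈ range (k + 1 + 1), wnorm (P ((Y ^ m) f)) with hS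
    have h1 : ∑ m ∈ range (k + 1), wnorm (P ((Y ^ m) (Y f))) ≤ S := by
      rw [hS, sum_range_succ' _ (k + 1)]
      exact le_self_add
    have h2 : ∑ m ∈ range (k + 1), wnorm (P ((Y ^ m) f)) ≤ S := by
      rw [hS, sum_range_succ _ (k + 1)]
      exact le_self_add
    calc _ ≤ C * S + ‖c‖ₑ * (C * S) := by
          gcongr
          · exact (hC P Y (Y f)).trans (by gcongr)
          · exact (hC P Y f).trans (by gcongr)
      _ = _ := by
          push_cast
          simp only [enorm_eq_nnnorm]
          ring

lemma semiconjBy_opU_pow (ν : ℂ) (b : ℕ) :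
    SemiconjBy (opU ν ^ b) (opX + (2 * b : ℂ) • (1 : Module.End ℂ smoothOff)) opX := by
  induction b with
  | zero => simp [SemiconjBy]
  | succ b ih =>
    unfold SemiconjBy at ih ⊢
    have h : opX * opU ν ^ (b + 1) = opU ν * (opX * opU ν ^ b) + (2 : ℂ) • opU ν ^ (b + 1) := by
      rw [pow_succ']
      exact LinearMap.ext fun f => opX_opU ν _
    rw [h, ← ih, pow_succ']
    simp only [mul_add, mul_smul_comm, mul_one, mul_assoc]
    push_cast
    module

lemma wsum_opU_pow_le (b n : ℕ) : ∃ C : NNReal, ∀ (ν : ℂ) (f : smoothOff),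
    wsum n ((opU ν ^ b) f) ≤ C * ∑ k ∈ range n, wnorm ((opU ν ^ b) ((opX ^ k) f)) := by
  choose C hC using wnorm_add_smul_pow_le (2 * b : ℂ)
  refine ⟨∑ k ∈ range n, C k, fun ν f => ?_⟩
  rw [wsum]
  push_cast
  rw [sum_mul]
  refine sum_le_sum fun k hk => ?_
  have h : (opX ^ k) ((opU ν ^ b) f)
      = (opU ν ^ b) (((opX + (2 * b : ℂ) • (1 : Module.End ℂ smoothOff)) ^ k) f) :=
    (LinearMap.congr_fun ((semiconjBy_opU_pow ν b).pow_right k) f).symm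
  rw [h]
  refine (hC k _ _ f).trans ?_
  gcongr
  exact mem_range.1 hk

lemma wnorm_opU_pow_opX_pow_le (b n : ℕ) : ∃ C : NNReal, ∀ (ν : ℂ) (f : smoothOff),
    wnorm ((opU ν ^ b) ((opX ^ n) f)) ≤ C * wsum (n + 1) ((opU ν ^ b) f) := by
  obtain ⟨C, hC⟩ := wnorm_add_smul_pow_le (-(2 * b) : ℂ) n
  refine ⟨C, fun ν f => ?_⟩
  have h := hC (opU ν ^ b) (opX + (2 * b : ℂ) • (1 : Module.End ℂ smoothOff)) f
  rw [add_assoc, ← add_smul, add_neg_cancel, zero_smul, add_zero] at h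
  refine h.trans_eq ?_
  rw [wsum]
  congr 1
  refine sum_congr rfl fun k _ => ?_
  exact congrArg wnorm (LinearMap.congr_fun ((semiconjBy_opU_pow ν b).pow_right k) f)

lemma opM_opU_pow (lam : ℝ) (ν : ℂ) (b : ℕ) (f : smoothOff) :
    opM lam ((opU ν ^ (b + 1)) f) = (opU ν ^ (b + 1)) (opM lam f)
      + (-(Complex.I * (b + 1))) • (opX ((opU ν ^ b) f) + (-b : ℂ) • (opU ν ^ b) f) := by
  induction b with
  | zero =>
    simp only [zero_add, pow_one, pow_zero, Module.End.one_apply, opM_opU, Nat.cast_zero]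
    module
  | succ b ih =>
    have h : opU ν (opX ((opU ν ^ b) f))
        = opX ((opU ν ^ (b + 1)) f) - (2 : ℂ) • (opU ν ^ (b + 1)) f := by
      rw [pow_succ', Module.End.mul_apply, opX_opU]
      module
    rw [pow_succ' _ (b + 1), Module.End.mul_apply, opM_opU, ih]
    simp only [map_add, map_smul, h, ← Module.End.mul_apply (opU ν),
      ← pow_succ']
    push_cast
    module

/-- The estimate for the solution with all iterates of `calX` on the left. -/
lemma enorm_mul_wsum_opU_pow_le (b : ℕ) : ∀ a : ℕ, ∃ C : NNReal,
    ∀ (ν : ℂ) (lam : ℝ), lam ≠ 0 → ∀ f : smoothOff,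
      ‖(lam : ℂ)‖ₑ * wsum a ((opU ν ^ b) f) ≤
        C * ∑ j ∈ range (b + 1), ‖(lam : ℂ)‖ₑ⁻¹ ^ (b - j) *
          wsum (a + 1 + 2 * b - j) ((opU ν ^ j) (opM lam f)) := by
  induction b with
  | zero =>
    intro a
    obtain ⟨C, hC⟩ := enorm_mul_wsum_le a
    exact ⟨C, fun ν lam hlam f => by simpa using hC lam hlam f⟩
  | succ b ih =>
    intro a
    obtain ⟨C, hC⟩ := enorm_mul_wsum_le a
    obtain ⟨C', hC'⟩ := ih (a + 2)
    let D : NNReal := ‖Complex.I * (b + 1)‖₊ * (1 + ‖(-b : ℂ)‖₊)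
    refine ⟨C * (1 + D * C'), fun ν lam hlam f => ?_⟩
    set ℓ := ‖(lam : ℂ)‖ₑ with hℓ
    have hℓ0 : ℓ ≠ 0 := by simpa [hℓ] using hlam
    have hℓt : ℓ ≠ ⊤ := enorm_ne_top
    set T := ∑ j ∈ range (b + 1), ℓ⁻¹ ^ (b + 1 - j) *
      wsum (a + 1 + 2 * (b + 1) - j) ((opU ν ^ j) (opM lam f)) with hT
    have hU : wsum (a + 2) ((opU ν ^ b) f) ≤ C' * T := by
      have h1 := mul_le_mul_right (hC' ν lam hlam f) ℓ⁻¹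
      rw [← mul_assoc, ENNReal.inv_mul_cancel hℓ0 hℓt, one_mul] at h1
      refine h1.trans_eq ?_
      rw [mul_left_comm, hT, mul_sum]
      congr 1
      refine sum_congr rfl fun j hj => ?_
      have hj' : j ≤ b := Nat.lt_succ_iff.1 (mem_range.1 hj)
      rw [← mul_assoc, ← pow_succ', show b - j + 1 = b + 1 - j by omega,
        show a + 2 + 1 + 2 * b - j = a + 1 + 2 * (b + 1) - j by omega]
    have hG : wsum (a + 1) (opM lam ((opU ν ^ (b + 1)) f)) ≤
        wsum (a + 1) ((opU ν ^ (b + 1)) (opM lam f)) + D * (C' * T) := by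
      rw [opM_opU_pow]
      refine (wsum_add_le _ _ _).trans (add_le_add_right ?_ _)
      rw [wsum_smul, enorm_neg]
      have h1 : wsum (a + 1) (opX ((opU ν ^ b) f) + (-b : ℂ) • (opU ν ^ b) f) ≤
          (1 + ‖(-b : ℂ)‖ₑ) * (C' * T) := by
        refine (wsum_add_le _ _ _).trans ?_
        rw [wsum_smul, add_mul, one_mul]
        gcongr
        · exact (wsum_opX_le _ _).trans hU
        · exact (wsum_mono (by omega) _).trans hU
      calc _ ≤ ‖Complex.I * (b + 1)‖ₑ * ((1 + ‖(-b : ℂ)‖ₑ) * (C' * T)) := by gcongr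
        _ = _ := by
            simp only [D, enorm_eq_nnnorm]
            push_cast
            ring
    rw [sum_range_succ, ← hT, Nat.sub_self, pow_zero, one_mul]
    set W := wsum (a + 1 + 2 * (b + 1) - (b + 1)) ((opU ν ^ (b + 1)) (opM lam f)) with hW
    have hW' : wsum (a + 1) ((opU ν ^ (b + 1)) (opM lam f)) ≤ W := wsum_mono (by omega) _
    calc _ ≤ C * (W + D * (C' * T)) :=
          (hC lam hlam _).trans (by gcongr; exact hG.trans (by gcongr))
      _ ≤ C * (W + D * (C' * T)) + C * (T + D * (C' * W)) := le_self_add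
      _ = _ := by
          push_cast
          ring

end smoothOff

lemma ENNReal.pow_le_one_add_pow (x : ENNReal) {m n : ℕ} (h : m ≤ n) : x ^ m ≤ 1 + x ^ n := by
  rcases le_total x 1 with hx | hx
  · exact (pow_le_one₀ zero_le hx).trans le_self_add
  · exact (pow_le_pow_right₀ hx h).trans le_add_self

/-- Main estimate for the solution `f(ξ) = i·g(ξ)/(ξ−λ)` (extended at `ξ = λ` by
`f(λ) = i·g′(λ)`) of the twisted cohomological equation `(𝒱 + iλ)f = g`:
`‖𝒰^β 𝒳^α f‖_{𝕃²(ℝ)} ≤ C (1+|λ|^{-β})/|λ| · Σ_{j+k ≤ α+2β+1, j ≤ β} ‖𝒰^j 𝒳^k g‖_{𝕃²(ℝ)}`. -/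
theorem twisted_solution_estimate (α β : ℕ) :
    ∃ C > 0, ∀ (ν : ℂ) (lam : ℝ), lam ≠ 0 →
      ∀ g : ℝ → ℂ, ContDiffOn ℝ (⊤ : ℕ∞) g {(0 : ℝ)}ᶜ → g lam = 0 →
        L2w ((calU ν)^[β] (calX^[α]
            (fun ξ : ℝ => if ξ = lam then Complex.I * deriv g lam
              else Complex.I * g ξ / ((ξ : ℂ) - (lam : ℂ)))))
          Set.univ ≤
        ENNReal.ofReal (C * (1 + |lam| ^ (-(β : ℤ))) / |lam|) *
          ∑ j ∈ range (β + 1), ∑ k ∈ range (α + 2 * β + 2 - j),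
            L2w ((calU ν)^[j] (calX^[k] g)) Set.univ := by
  choose C₁ hC₁ using fun j => smoothOff.wsum_opU_pow_le j (α + 2 * β + 2 - j)
  obtain ⟨C₂, hC₂⟩ := smoothOff.wnorm_opU_pow_opX_pow_le β α
  obtain ⟨C₃, hC₃⟩ := smoothOff.enorm_mul_wsum_opU_pow_le β (α + 1)
  let D : NNReal := ∑ j ∈ range (β + 1), C₁ j
  refine ⟨(C₂ * C₃ * D : NNReal) + 1, by positivity, fun ν lam hlam g hg hg0 => ?_⟩
  let G : smoothOff := ⟨g, hg⟩
  let F : smoothOff := ⟨_, contDiffOn_twisted_solution hlam hg hg0⟩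
  have hMF : smoothOff.opM lam F = Complex.I • G := by
    ext ξ
    rw [smoothOff.opM_apply]
    change ((ξ : ℂ) - lam) * (if ξ = lam then Complex.I * deriv g lam
      else Complex.I * g ξ / ((ξ : ℂ) - (lam : ℂ))) = Complex.I * g ξ
    split_ifs with h
    · simp [h, hg0]
    · rw [mul_div_cancel₀]
      rw [sub_ne_zero]
      exact_mod_cast h
  have hl0 : 0 < |lam| := abs_pos.2 hlam
  set ℓ := ‖(lam : ℂ)‖ₑ with hℓ
  have hℓ' : ℓ = ENNReal.ofReal |lam| := by
    rw [hℓ, ← ofReal_norm, Complex.norm_real, Real.norm_eq_abs]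
  have hℓ0 : ℓ ≠ 0 := by simpa [hℓ] using hlam
  have hℓt : ℓ ≠ ⊤ := enorm_ne_top
  set S := ∑ j ∈ range (β + 1), ∑ k ∈ range (α + 2 * β + 2 - j),
    L2w ((calU ν)^[j] (calX^[k] g)) Set.univ with hS
  have hterm : ∀ j ∈ range (β + 1), ℓ⁻¹ ^ (β - j) * smoothOff.wsum (α + 1 + 1 + 2 * β - j)
      ((smoothOff.opU ν ^ j) (smoothOff.opM lam F)) ≤ (1 + ℓ⁻¹ ^ β) * (C₁ j * S) := by
    intro j hj
    refine mul_le_mul' (ENNReal.pow_le_one_add_pow _ (Nat.sub_le _ _)) ?_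
    rw [show α + 1 + 1 + 2 * β - j = α + 2 * β + 2 - j by omega]
    refine (hC₁ j ν _).trans ?_
    gcongr
    rw [hMF]
    refine le_trans (sum_le_sum fun k _ => ?_) (single_le_sum
      (f := fun j => ∑ k ∈ range (α + 2 * β + 2 - j), L2w ((calU ν)^[j] (calX^[k] g)) Set.univ)
      (fun _ _ => zero_le) hj)
    rw [map_smul, map_smul, smoothOff.wnorm_smul, smoothOff.wnorm, smoothOff.coe_opU_pow,
      smoothOff.coe_opX_pow]
    simp [G, enorm_eq_nnnorm]
  have hmain : ℓ * smoothOff.wsum (α + 1) ((smoothOff.opU ν ^ β) F) ≤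
      C₃ * ((1 + ℓ⁻¹ ^ β) * (D * S)) := by
    refine (hC₃ ν lam hlam F).trans ?_
    gcongr
    refine (sum_le_sum hterm).trans_eq ?_
    rw [← mul_sum, ← sum_mul]
    simp only [D]
    push_cast
    rfl
  have hconst : ENNReal.ofReal
      (((C₂ * C₃ * D : NNReal) + 1) * (1 + |lam| ^ (-(β : ℤ))) / |lam|)
        = ((C₂ * C₃ * D : NNReal) + 1) * (1 + ℓ⁻¹ ^ β) * ℓ⁻¹ := by
    rw [div_eq_mul_inv, ENNReal.ofReal_mul (by positivity), ENNReal.ofReal_mul (by positivity),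
      ENNReal.ofReal_add (by positivity) zero_le_one, ENNReal.ofReal_coe_nnreal,
      ENNReal.ofReal_one, ENNReal.ofReal_add zero_le_one (by positivity), ENNReal.ofReal_one,
      zpow_neg, zpow_natCast, ← inv_pow, ENNReal.ofReal_pow (by positivity),
      ENNReal.ofReal_inv_of_pos hl0, hℓ']
  rw [hconst]
  have hLHS : L2w ((calU ν)^[β] (calX^[α]
      (fun ξ : ℝ => if ξ = lam then Complex.I * deriv g lam
        else Complex.I * g ξ / ((ξ : ℂ) - (lam : ℂ))))) Set.univ
      = smoothOff.wnorm ((smoothOff.opU ν ^ β) ((smoothOff.opX ^ α) F)) := by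
    rw [smoothOff.wnorm, smoothOff.coe_opU_pow, smoothOff.coe_opX_pow]
  rw [hLHS]
  calc _ ≤ C₂ * smoothOff.wsum (α + 1) ((smoothOff.opU ν ^ β) F) := hC₂ ν F
    _ = C₂ * (ℓ⁻¹ * (ℓ * smoothOff.wsum (α + 1) ((smoothOff.opU ν ^ β) F))) := by
        rw [← mul_assoc ℓ⁻¹, ENNReal.inv_mul_cancel hℓ0 hℓt, one_mul]
    _ ≤ C₂ * (ℓ⁻¹ * (C₃ * ((1 + ℓ⁻¹ ^ β) * (D * S)))) := by gcongr
    _ ≤ C₂ * (ℓ⁻¹ * (C₃ * ((1 + ℓ⁻¹ ^ β) * (D * S)))) + (1 + ℓ⁻¹ ^ β) * ℓ⁻¹ * S :=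
        le_self_add
    _ = _ := by
        push_cast
        ring
end

section
/- For every β, σ ∈ ℕ with σ ≤ β and every constant C > 0, there exist a nonzero real number a (with ν = ia) and smooth compactly supported functions f, g : ℝ → ℂ, both supported in [3/4, 4/3], satisfying (ξ − 1)·f(ξ) = −i·g(ξ) for all ξ ∈ ℝ (so that f solves the twisted cohomological equation (V̂ + i)f = g), such that ‖Û^β f‖_{L²(ℝ)} > C · Σ_{j+k+l ≤ β+σ} ‖V̂^j X̂^k Û^l g‖_{L²(ℝ)}, where the L² norms are with respect to Lebesgue measure. In particular, the solution of the twisted cohomological equation does not satisfy a tame estimate losing only σ derivatives for any integer σ ≤ β. -/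
open Complex Finset MeasureTheory

/-- The operator `V̂ f (ξ) = -i ξ f(ξ)`. -/
noncomputable def hatV (f : ℝ → ℂ) : ℝ → ℂ := fun ξ => -Complex.I * (ξ : ℂ) * f ξ

/-- The operator `X̂ f (ξ) = (ν−1) f(ξ) − 2ξ f′(ξ)`. -/
noncomputable def hatX (ν : ℂ) (f : ℝ → ℂ) : ℝ → ℂ :=
  fun ξ => (ν - 1) * f ξ - 2 * (ξ : ℂ) * deriv f ξ

/-- The operator `Û f (ξ) = i((ν−1)·f′(ξ) − ξ·f″(ξ))`. -/
noncomputable def hatU (ν : ℂ) (f : ℝ → ℂ) : ℝ → ℂ :=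
  fun ξ => Complex.I * ((ν - 1) * deriv f ξ - (ξ : ℂ) * deriv (deriv f) ξ)

/-- The `L²(J, dξ)` norm (Lebesgue measure), valued in `ℝ≥0∞`. -/
noncomputable def L2 (h : ℝ → ℂ) (J : Set ℝ) : ENNReal :=
  (∫⁻ ξ in J, ENNReal.ofReal (‖h ξ‖ ^ 2)) ^ (1 / 2 : ℝ)

open Filter Topology

/-- The power function `ξ ↦ ξ ^ μ` on the positive half-line. -/
noncomputable def powFn (μ : ℂ) : ℝ → ℂ := fun ξ => cexp (μ * (Real.log ξ : ℂ))

/-- Smooth functions supported in `[3/4, 4/3]`. -/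
def IsCutoff (φ : ℝ → ℂ) : Prop :=
  ContDiff ℝ (⊤ : ℕ∞) φ ∧ Function.support φ ⊆ Set.Icc (3 / 4 : ℝ) (4 / 3)

/-- Polynomials of degree at most `d` in the parameter `n`, with coefficients smooth functions
supported in `[3/4, 4/3]`. -/
inductive IsSymbol : ℕ → (ℕ → ℝ → ℂ) → Prop
  | const {φ : ℝ → ℂ} : IsCutoff φ → IsSymbol 0 (fun _ => φ)
  | add {d : ℕ} {p q : ℕ → ℝ → ℂ} :
      IsSymbol d p → IsSymbol d q → IsSymbol d (fun n ξ => p n ξ + q n ξ)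
  | scale {d : ℕ} {p : ℕ → ℝ → ℂ} : IsSymbol d p → IsSymbol (d + 1) (fun n ξ => (n : ℂ) * p n ξ)
  | succ {d : ℕ} {p : ℕ → ℝ → ℂ} : IsSymbol d p → IsSymbol (d + 1) p

/-- Families `ξ ^ (i n) p_n + r_n` with symbols `p`, `r` of degree `d`. -/
def IsOscillatory (d : ℕ) (h : ℕ → ℝ → ℂ) : Prop :=
  ∃ p r : ℕ → ℝ → ℂ, IsSymbol d p ∧ IsSymbol d r ∧
    ∀ n, h n = fun ξ => powFn (I * (n : ℝ)) ξ * p n ξ + r n ξ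

theorem contDiffAt_powFn (μ : ℂ) {ξ : ℝ} (hξ : ξ ≠ 0) {n : WithTop ℕ∞} :
    ContDiffAt ℝ n (powFn μ) ξ := by
  have h1 : ContDiffAt ℝ n (fun ξ : ℝ => (Real.log ξ : ℂ)) ξ :=
    Complex.ofRealCLM.contDiff.contDiffAt.comp ξ (Real.contDiffAt_log.2 hξ)
  exact (contDiffAt_const.mul h1).cexp

theorem powFn_sub_one (μ : ℂ) {ξ : ℝ} (hξ : 0 < ξ) :
    powFn (μ - 1) ξ = powFn μ ξ * (ξ : ℂ)⁻¹ := by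
  have : cexp (Real.log ξ : ℂ) = ξ := by
    rw [← Complex.ofReal_exp, Real.exp_log hξ]
  simp only [powFn]
  rw [sub_mul, Complex.exp_sub, one_mul, this, div_eq_mul_inv]

theorem hasDerivAt_powFn (μ : ℂ) {ξ : ℝ} (hξ : 0 < ξ) :
    HasDerivAt (powFn μ) (μ * powFn (μ - 1) ξ) ξ := by
  have h1 : HasDerivAt (fun ξ : ℝ => μ * (Real.log ξ : ℂ)) (μ * ((ξ⁻¹ : ℝ) : ℂ)) ξ :=
    ((Real.hasDerivAt_log hξ.ne').ofReal_comp).const_mul μ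
  refine HasDerivAt.congr_deriv (f := powFn μ) h1.cexp ?_
  rw [powFn_sub_one μ hξ, powFn]
  push_cast
  ring

theorem norm_powFn_I (x : ℝ) (ξ : ℝ) : ‖powFn (I * x) ξ‖ = 1 := by
  have : I * (x : ℂ) * (Real.log ξ : ℂ) = ((x * Real.log ξ : ℝ) : ℂ) * I := by push_cast; ring
  rw [powFn, this, Complex.norm_exp_ofReal_mul_I]

namespace IsCutoff

theorem eventually_eq_zero {φ : ℝ → ℂ} (h : IsCutoff φ) {ξ : ℝ} (hξ : ξ ≤ 1 / 2) :
    φ =ᶠ[𝓝 ξ] fun _ => 0 := by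
  filter_upwards [Iio_mem_nhds (show ξ < 3 / 4 by linarith)] with x hx
  by_contra h0
  exact absurd (h.2 h0).1 (not_le.2 hx)

theorem mul {φ ψ : ℝ → ℂ} (h : IsCutoff φ)
    (hψ : ∀ ξ ∈ Set.Ioo (1 / 2 : ℝ) 2, ContDiffAt ℝ (⊤ : ℕ∞) ψ ξ) :
    IsCutoff (fun ξ => ψ ξ * φ ξ) := by
  refine ⟨contDiff_iff_contDiffAt.2 fun ξ => ?_, fun ξ hξ => h.2 (right_ne_zero_of_mul hξ)⟩
  by_cases hξ : ξ ∈ Set.Ioo (1 / 2 : ℝ) 2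
  · exact (hψ ξ hξ).mul h.1.contDiffAt
  · have h0 : φ =ᶠ[𝓝 ξ] fun _ => 0 := by
      have hc : (Set.Icc (3 / 4 : ℝ) (4 / 3))ᶜ ∈ 𝓝 ξ := by
        refine isClosed_Icc.isOpen_compl.mem_nhds fun h' => hξ ⟨?_, ?_⟩
        · linarith [h'.1]
        · linarith [h'.2]
      filter_upwards [hc] with x hx
      by_contra h0
      exact hx (h.2 h0)
    refine (contDiffAt_const (c := (0 : ℂ))).congr_of_eventuallyEq ?_
    filter_upwards [h0] with x hx
    simp [hx]

theorem add {φ ψ : ℝ → ℂ} (h : IsCutoff φ) (h' : IsCutoff ψ) :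
    IsCutoff (fun ξ => φ ξ + ψ ξ) := by
  refine ⟨h.1.add h'.1, fun ξ hξ => ?_⟩
  by_contra h0
  have h1 : φ ξ = 0 := by by_contra h2; exact h0 (h.2 h2)
  have h2 : ψ ξ = 0 := by by_contra h2; exact h0 (h'.2 h2)
  exact hξ (by simp [h1, h2])

theorem deriv {φ : ℝ → ℂ} (h : IsCutoff φ) : IsCutoff (deriv φ) := by
  refine ⟨(contDiff_infty_iff_deriv.1 h.1).2, ?_⟩
  refine (subset_tsupport _).trans ((tsupport_deriv_subset).trans ?_)
  exact closure_minimal h.2 isClosed_Icc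

theorem hasCompactSupport {φ : ℝ → ℂ} (h : IsCutoff φ) : HasCompactSupport φ :=
  HasCompactSupport.of_support_subset_isCompact isCompact_Icc h.2

theorem differentiable {φ : ℝ → ℂ} (h : IsCutoff φ) : Differentiable ℝ φ :=
  h.1.differentiable (by simp)

theorem hasDerivAt_powFn_mul {φ : ℝ → ℂ} (h : IsCutoff φ) (ν : ℂ) (ξ : ℝ) :
    HasDerivAt (fun ξ => powFn ν ξ * φ ξ)
      (powFn ν ξ * (_root_.deriv φ ξ + ν * ((ξ : ℂ)⁻¹ * φ ξ))) ξ := by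
  rcases le_or_gt ξ (1 / 2) with hξ | hξ
  · have h0 := h.eventually_eq_zero hξ
    have h1 : _root_.deriv φ ξ = 0 := by rw [h0.deriv_eq]; simp
    have h2 : φ ξ = 0 := h0.self_of_nhds
    rw [h1, h2]
    simp only [mul_zero, add_zero]
    refine (hasDerivAt_const ξ (0 : ℂ)).congr_of_eventuallyEq ?_
    filter_upwards [h0] with x hx
    simp [hx]
  · have hpos : 0 < ξ := by linarith
    refine ((hasDerivAt_powFn ν hpos).fun_mul (h.differentiable ξ).hasDerivAt).congr_deriv ?_
    rw [powFn_sub_one ν hpos]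
    ring

end IsCutoff

theorem contDiffAt_inv_ofReal {ξ : ℝ} (hξ : ξ ≠ 0) :
    ContDiffAt ℝ (⊤ : ℕ∞) (fun ξ : ℝ => (ξ : ℂ)⁻¹) ξ :=
  (Complex.ofRealCLM.contDiff.contDiffAt (x := ξ)).inv (by simpa using hξ)

namespace IsSymbol

theorem isCutoff {d : ℕ} {p : ℕ → ℝ → ℂ} (h : IsSymbol d p) (n : ℕ) : IsCutoff (p n) := by
  induction h with
  | const h => exact h
  | add _ _ h1 h2 => exact h1.add h2
  | scale _ h => exact h.mul fun _ _ => contDiffAt_const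
  | succ _ h => exact h

theorem mul {d : ℕ} {p : ℕ → ℝ → ℂ} (h : IsSymbol d p) {ψ : ℝ → ℂ}
    (hψ : ∀ ξ ∈ Set.Ioo (1 / 2 : ℝ) 2, ContDiffAt ℝ (⊤ : ℕ∞) ψ ξ) :
    IsSymbol d (fun n ξ => ψ ξ * p n ξ) := by
  induction h with
  | const h => exact const (h.mul hψ)
  | add _ _ h1 h2 => simpa only [mul_add] using h1.add h2
  | scale _ h => simpa only [mul_left_comm] using h.scale
  | succ _ h => exact h.succ

theorem const_mul {d : ℕ} {p : ℕ → ℝ → ℂ} (h : IsSymbol d p) (c : ℂ) :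
    IsSymbol d (fun n ξ => c * p n ξ) :=
  h.mul fun _ _ => contDiffAt_const

theorem ofReal_mul {d : ℕ} {p : ℕ → ℝ → ℂ} (h : IsSymbol d p) :
    IsSymbol d (fun n ξ => (ξ : ℂ) * p n ξ) :=
  h.mul fun _ _ => Complex.ofRealCLM.contDiff.contDiffAt

theorem deriv {d : ℕ} {p : ℕ → ℝ → ℂ} (h : IsSymbol d p) :
    IsSymbol d (fun n => deriv (p n)) := by
  induction h with
  | const h => exact const h.deriv
  | @add d p q hp hq h1 h2 =>
    convert h1.add h2 using 3 with n ξ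
    exact deriv_fun_add ((hp.isCutoff n).differentiable ξ) ((hq.isCutoff n).differentiable ξ)
  | @scale d p hp h =>
    convert h.scale using 3 with n ξ
    exact deriv_const_mul _ ((hp.isCutoff n).differentiable ξ)
  | succ _ h => exact h.succ

theorem bound {d : ℕ} {p : ℕ → ℝ → ℂ} (h : IsSymbol d p) :
    ∃ K : ℝ, 0 ≤ K ∧ ∀ n : ℕ, 1 ≤ n → ∀ ξ, ‖p n ξ‖ ≤ K * (n : ℝ) ^ d := by
  induction h with
  | @const φ h =>
    obtain ⟨K, hK⟩ := h.hasCompactSupport.exists_bound_of_continuous h.1.continuous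
    exact ⟨K, (norm_nonneg _).trans (hK 0), fun n _ ξ => by simpa using hK ξ⟩
  | add _ _ h1 h2 =>
    obtain ⟨K, hK0, hK⟩ := h1
    obtain ⟨L, hL0, hL⟩ := h2
    refine ⟨K + L, by positivity, fun n hn ξ => (norm_add_le _ _).trans ?_⟩
    linarith [hK n hn ξ, hL n hn ξ]
  | scale _ h =>
    obtain ⟨K, hK0, hK⟩ := h
    refine ⟨K, hK0, fun n hn ξ => ?_⟩
    rw [norm_mul, Complex.norm_natCast, pow_succ]
    nlinarith [hK n hn ξ, (Nat.cast_nonneg n : (0 : ℝ) ≤ n)]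
  | succ _ h =>
    obtain ⟨K, hK0, hK⟩ := h
    refine ⟨K, hK0, fun n hn ξ => (hK n hn ξ).trans ?_⟩
    have : (1 : ℝ) ≤ n := by exact_mod_cast hn
    gcongr
    · simp

end IsSymbol

namespace IsOscillatory

theorem hatV {d : ℕ} {h : ℕ → ℝ → ℂ} (H : IsOscillatory d h) :
    IsOscillatory d (fun n => hatV (h n)) := by
  obtain ⟨p, r, hp, hr, hh⟩ := H
  refine ⟨_, _, (hp.ofReal_mul.const_mul (-I)), (hr.ofReal_mul.const_mul (-I)), fun n => ?_⟩
  ext ξ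
  simp only [_root_.hatV, hh]
  ring

theorem deriv_eq {p r : ℝ → ℂ} (hp : IsCutoff p) (hr : IsCutoff r) (ν : ℂ) :
    deriv (fun ξ => powFn ν ξ * p ξ + r ξ) =
      fun ξ => powFn ν ξ * (deriv p ξ + ν * ((ξ : ℂ)⁻¹ * p ξ)) + deriv r ξ := by
  ext ξ
  exact ((hp.hasDerivAt_powFn_mul ν ξ).add (hr.differentiable ξ).hasDerivAt).deriv

theorem isCutoff_inv_mul {p : ℝ → ℂ} (hp : IsCutoff p) : IsCutoff (fun ξ => (ξ : ℂ)⁻¹ * p ξ) :=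
  hp.mul fun ξ hξ => contDiffAt_inv_ofReal (by linarith [hξ.1])

theorem deriv_inv_mul {p : ℝ → ℂ} (hp : IsCutoff p) {ξ : ℝ} (hξ : ξ ≠ 0) :
    deriv (fun ξ : ℝ => (ξ : ℂ)⁻¹ * p ξ) ξ =
      (ξ : ℂ)⁻¹ * deriv p ξ - (ξ : ℂ)⁻¹ * (ξ : ℂ)⁻¹ * p ξ := by
  have h1 : HasDerivAt (fun ξ : ℝ => (ξ : ℂ)⁻¹) (-1 / (ξ : ℂ) ^ 2) ξ :=
    (Complex.ofRealCLM.hasDerivAt (x := ξ)).fun_inv (by simpa using hξ)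
  rw [(h1.fun_mul (hp.differentiable ξ).hasDerivAt).deriv]
  have : (ξ : ℂ) ≠ 0 := by simpa using hξ
  field_simp
  ring

theorem deriv_deriv_eq {p r : ℝ → ℂ} (hp : IsCutoff p) (hr : IsCutoff r) (ν : ℂ) (ξ : ℝ) :
    (ξ : ℂ) * deriv (deriv (fun ξ => powFn ν ξ * p ξ + r ξ)) ξ =
      powFn ν ξ * (ξ * deriv (deriv p) ξ + 2 * ν * deriv p ξ + ν * (ν - 1) * ((ξ : ℂ)⁻¹ * p ξ)) +
        ξ * deriv (deriv r) ξ := by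
  have hq := isCutoff_inv_mul hp
  have hq' : IsCutoff (fun ξ : ℝ => ν * ((ξ : ℂ)⁻¹ * p ξ)) :=
    hq.mul fun _ _ => contDiffAt_const
  rw [deriv_eq hp hr, deriv_eq (hp.deriv.add hq') hr.deriv]
  rcases eq_or_ne ξ 0 with rfl | hξ
  · have h0 := hp.eventually_eq_zero (ξ := 0) (by norm_num)
    have h1 : deriv p 0 = 0 := by rw [h0.deriv_eq]; simp
    simp [h1]
  · have : (ξ : ℂ) ≠ 0 := by simpa using hξ
    simp only []
    rw [deriv_fun_add (hp.deriv.differentiable ξ) (hq'.differentiable ξ),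
      deriv_const_mul _ (hq.differentiable ξ), deriv_inv_mul hp hξ]
    field_simp
    ring

theorem hatX {d : ℕ} {h : ℕ → ℝ → ℂ} (H : IsOscillatory d h) :
    IsOscillatory (d + 1) (fun n => hatX (I * (n : ℝ)) (h n)) := by
  obtain ⟨p, r, hp, hr, hh⟩ := H
  have hp' := ((hp.const_mul (-I)).scale.add (hp.const_mul (-1)).succ).add
    (hp.deriv.ofReal_mul.const_mul (-2)).succ
  have hr' := ((hr.const_mul I).scale.add (hr.const_mul (-1)).succ).add
    (hr.deriv.ofReal_mul.const_mul (-2)).succ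
  refine ⟨_, _, hp', hr', fun n => ?_⟩
  ext ξ
  simp only [_root_.hatX, hh, deriv_eq (hp.isCutoff n) (hr.isCutoff n)]
  rcases eq_or_ne ξ 0 with rfl | hξ
  · have h0 : p n 0 = 0 := ((hp.isCutoff n).eventually_eq_zero (by norm_num)).self_of_nhds
    simp [h0]
    ring
  · have : (ξ : ℂ) ≠ 0 := by simpa using hξ
    push_cast
    field_simp
    ring

theorem hatU {d : ℕ} {h : ℕ → ℝ → ℂ} (H : IsOscillatory d h) :
    IsOscillatory (d + 1) (fun n => hatU (I * (n : ℝ)) (h n)) := by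
  obtain ⟨p, r, hp, hr, hh⟩ := H
  have hp' := ((hp.deriv.const_mul (-I * I)).scale.add (hp.deriv.const_mul (-I)).succ).add
    (hp.deriv.deriv.ofReal_mul.const_mul (-I)).succ
  have hr' := ((hr.deriv.const_mul (I * I)).scale.add (hr.deriv.const_mul (-I)).succ).add
    (hr.deriv.deriv.ofReal_mul.const_mul (-I)).succ
  refine ⟨_, _, hp', hr', fun n => ?_⟩
  ext ξ
  simp only [_root_.hatU, hh]
  rw [deriv_deriv_eq (hp.isCutoff n) (hr.isCutoff n), deriv_eq (hp.isCutoff n) (hr.isCutoff n)]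
  push_cast
  ring

theorem iterate {d k : ℕ} {T : ℕ → (ℝ → ℂ) → ℝ → ℂ} {h : ℕ → ℝ → ℂ}
    (hT : ∀ {d h}, IsOscillatory d h → IsOscillatory (d + k) (fun n => T n (h n)))
    (H : IsOscillatory d h) (l : ℕ) : IsOscillatory (d + l * k) (fun n => (T n)^[l] (h n)) := by
  induction l with
  | zero => simpa using H
  | succ l ih =>
    simp only [Function.iterate_succ_apply']
    convert hT ih using 1
    ring

theorem L2_le {d : ℕ} {h : ℕ → ℝ → ℂ} (H : IsOscillatory d h) :
    ∃ K : ℝ, 0 ≤ K ∧ ∀ n : ℕ, 1 ≤ n → L2 (h n) Set.univ ≤ ENNReal.ofReal (K * (n : ℝ) ^ d) := by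
  obtain ⟨p, r, hp, hr, hh⟩ := H
  obtain ⟨K, hK0, hK⟩ := hp.bound
  obtain ⟨L, hL0, hL⟩ := hr.bound
  refine ⟨K + L, by positivity, fun n hn => ?_⟩
  set M := (K + L) * (n : ℝ) ^ d with hM
  have hM0 : 0 ≤ M := by positivity
  have hb : ∀ ξ, ENNReal.ofReal (‖h n ξ‖ ^ 2) ≤
      (Set.Icc (3 / 4 : ℝ) (4 / 3)).indicator (fun _ => ENNReal.ofReal (M ^ 2)) ξ := by
    intro ξ
    by_cases hξ : ξ ∈ Set.Icc (3 / 4 : ℝ) (4 / 3)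
    · rw [Set.indicator_of_mem hξ]
      refine ENNReal.ofReal_le_ofReal (pow_le_pow_left₀ (norm_nonneg _) ?_ 2)
      rw [hh]
      refine (norm_add_le _ _).trans ?_
      rw [norm_mul, norm_powFn_I, one_mul, hM]
      linarith [hK n hn ξ, hL n hn ξ]
    · have h1 : p n ξ = 0 := by by_contra h2; exact hξ ((hp.isCutoff n).2 h2)
      have h2 : r n ξ = 0 := by by_contra h2; exact hξ ((hr.isCutoff n).2 h2)
      simp [hh, h1, h2]
  have hI : ∫⁻ ξ in Set.univ, ENNReal.ofReal (‖h n ξ‖ ^ 2) ≤ ENNReal.ofReal (M ^ 2) := by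
    rw [Measure.restrict_univ]
    refine (lintegral_mono hb).trans ?_
    rw [lintegral_indicator measurableSet_Icc, setLIntegral_const, Real.volume_Icc]
    refine mul_le_of_le_one_right' ?_
    rw [← ENNReal.ofReal_one]
    exact ENNReal.ofReal_le_ofReal (by norm_num)
  refine (ENNReal.rpow_le_rpow hI (by norm_num)).trans ?_
  rw [ENNReal.ofReal_rpow_of_nonneg (by positivity) (by norm_num), ← Real.sqrt_eq_rpow,
    Real.sqrt_sq hM0]

end IsOscillatory

theorem exists_sum_L2_le {g : ℕ → ℝ → ℂ} (hg : IsOscillatory 0 g) (N : ℕ) :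
    ∃ K : ℝ, 0 ≤ K ∧ ∀ n : ℕ, 1 ≤ n →
      (∑ j ∈ range (N + 1), ∑ k ∈ range (N + 1 - j), ∑ l ∈ range (N + 1 - j - k),
        L2 (hatV^[j] ((hatX (I * (n : ℝ)))^[k] ((hatU (I * (n : ℝ)))^[l] (g n)))) Set.univ) ≤
      ENNReal.ofReal (K * (n : ℝ) ^ N) := by
  have H : ∀ j k l : ℕ, ∃ K : ℝ, 0 ≤ K ∧ ∀ n : ℕ, 1 ≤ n → k + l ≤ N →
      L2 (hatV^[j] ((hatX (I * (n : ℝ)))^[k] ((hatU (I * (n : ℝ)))^[l] (g n)))) Set.univ ≤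
        ENNReal.ofReal (K * (n : ℝ) ^ N) := by
    intro j k l
    have h1 := IsOscillatory.iterate (T := fun n => hatU (I * (n : ℝ))) (k := 1)
      (fun h => h.hatU) hg l
    have h2 := IsOscillatory.iterate (T := fun n => hatX (I * (n : ℝ))) (k := 1)
      (fun h => h.hatX) h1 k
    have h3 := IsOscillatory.iterate (T := fun _ => hatV) (k := 0) (fun h => h.hatV) h2 j
    obtain ⟨K, hK0, hK⟩ := h3.L2_le
    refine ⟨K, hK0, fun n hn hkl => (hK n hn).trans (ENNReal.ofReal_le_ofReal ?_)⟩
    have : (1 : ℝ) ≤ n := by exact_mod_cast hn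
    gcongr
    omega
  choose K hK0 hK using H
  refine ⟨∑ j ∈ range (N + 1), ∑ k ∈ range (N + 1 - j), ∑ l ∈ range (N + 1 - j - k), K j k l,
    sum_nonneg fun j _ => sum_nonneg fun k _ => sum_nonneg fun l _ => hK0 j k l, fun n hn => ?_⟩
  simp only [sum_mul]
  have hnn : ∀ j k l, 0 ≤ K j k l * (n : ℝ) ^ N := fun j k l =>
    mul_nonneg (hK0 j k l) (by positivity)
  rw [ENNReal.ofReal_sum_of_nonneg fun j _ => sum_nonneg fun k _ => sum_nonneg fun l _ => hnn j k l]
  refine sum_le_sum fun j _ => ?_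
  rw [ENNReal.ofReal_sum_of_nonneg fun k _ => sum_nonneg fun l _ => hnn j k l]
  refine sum_le_sum fun k hk => ?_
  rw [ENNReal.ofReal_sum_of_nonneg fun l _ => hnn j k l]
  refine sum_le_sum fun l hl => hK j k l n hn ?_
  simp only [mem_range] at hk hl
  omega

theorem hatU_eqOn {S : Set ℝ} (hS : IsOpen S) {f g : ℝ → ℂ} (h : Set.EqOn f g S) (ν : ℂ) :
    Set.EqOn (hatU ν f) (hatU ν g) S := by
  intro ξ hξ
  have h0 : f =ᶠ[𝓝 ξ] g := h.eventuallyEq_of_mem (hS.mem_nhds hξ)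
  simp only [hatU, h0.deriv_eq, h0.deriv.deriv_eq]

theorem hatU_sum_powFn {S : Set ℝ} (hS : IsOpen S) (hpos : S ⊆ Set.Ioi 0) (s : Finset ℕ)
    (c μ : ℕ → ℂ) (ν : ℂ) :
    Set.EqOn (hatU ν (fun ξ => ∑ m ∈ s, c m * powFn (μ m) ξ))
      (fun ξ => ∑ m ∈ s, c m * (I * μ m * (ν - μ m)) * powFn (μ m - 1) ξ) S := by
  have hd : ∀ (c μ : ℕ → ℂ), ∀ ξ ∈ S, deriv (fun ξ => ∑ m ∈ s, c m * powFn (μ m) ξ) ξ =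
      ∑ m ∈ s, c m * μ m * powFn (μ m - 1) ξ := by
    intro c μ ξ hξ
    refine (HasDerivAt.fun_sum fun m _ => ?_).deriv
    simpa only [mul_assoc] using (hasDerivAt_powFn (μ m) (hpos hξ)).const_mul (c m)
  intro ξ hξ
  have h0 : (deriv fun ξ => ∑ m ∈ s, c m * powFn (μ m) ξ) =ᶠ[𝓝 ξ]
      fun ξ => ∑ m ∈ s, c m * μ m * powFn (μ m - 1) ξ :=
    Set.EqOn.eventuallyEq_of_mem (hd c μ) (hS.mem_nhds hξ)
  simp only [hatU]
  rw [h0.deriv_eq, hd c μ ξ hξ, hd (fun m => c m * μ m) (fun m => μ m - 1) ξ hξ, mul_sum, mul_sum,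
    ← sum_sub_distrib, mul_sum]
  refine sum_congr rfl fun m _ => ?_
  have : (ξ : ℂ) ≠ 0 := by simpa using (ne_of_gt (hpos hξ) : ξ ≠ 0)
  rw [powFn_sub_one (μ m - 1) (hpos hξ)]
  field_simp
  ring

theorem hatU_iterate_sum_powFn {S : Set ℝ} (hS : IsOpen S) (hpos : S ⊆ Set.Ioi 0) (s : Finset ℕ)
    (μ : ℕ → ℂ) (ν : ℂ) {f : ℝ → ℂ} (hf : Set.EqOn f (fun ξ => ∑ m ∈ s, powFn (μ m) ξ) S) (b : ℕ) :
    Set.EqOn ((hatU ν)^[b] f)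
      (fun ξ => ∑ m ∈ s, (∏ j ∈ range b, (I * (μ m - j) * (ν - (μ m - j)))) * powFn (μ m - b) ξ)
      S := by
  induction b with
  | zero => simpa using hf
  | succ b ih =>
    rw [Function.iterate_succ_apply']
    intro ξ hξ
    rw [hatU_eqOn hS ih ν hξ, hatU_sum_powFn hS hpos s _ (fun m => μ m - b) ν hξ]
    simp only [prod_range_succ, sub_sub, Nat.cast_add, Nat.cast_one]

theorem powFn_sub_natCast (μ : ℂ) {ξ : ℝ} (hξ : 0 < ξ) (b : ℕ) :
    powFn (μ - b) ξ = powFn μ ξ * ((ξ : ℂ) ^ b)⁻¹ := by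
  induction b with
  | zero => simp
  | succ b ih =>
    rw [Nat.cast_succ, ← sub_sub, powFn_sub_one _ hξ, ih, pow_succ, mul_inv]
    ring

/-- The eigenvalue product of the `b`-th iterate of `hatU` on `ξ ^ (i m)` differs from its leading
term by a lower-order quantity. -/
theorem exists_prod_sub_pow_le (b : ℕ) : ∃ K : ℝ, 0 ≤ K ∧ ∀ n m : ℕ, 1 ≤ n → m ≤ n →
    ‖(∏ j ∈ range b, (I * (I * (m : ℝ) - j) * (I * (n : ℝ) - (I * (m : ℝ) - j)))) -
      (-I * ((m : ℝ) * (n - m) : ℝ)) ^ b‖ * n ≤ K * (n : ℝ) ^ (2 * b) := by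
  induction b with
  | zero => exact ⟨0, le_rfl, by simp⟩
  | succ b ih =>
    obtain ⟨K, hK0, hK⟩ := ih
    set E : ℝ := (b : ℝ) ^ 2 + b with hE
    refine ⟨K * (1 + E) + E, by positivity, fun n m hn hm => ?_⟩
    have hn1 : (1 : ℝ) ≤ n := by exact_mod_cast hn
    have hmn : (m : ℝ) ≤ n := by exact_mod_cast hm
    have hm0 : (0 : ℝ) ≤ m := Nat.cast_nonneg m
    have hb0 : (0 : ℝ) ≤ b := Nat.cast_nonneg b
    rw [prod_range_succ]
    set P := ∏ j ∈ range b, (I * (I * (m : ℝ) - j) * (I * (n : ℝ) - (I * (m : ℝ) - j)))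
    set x : ℂ := -I * ((m : ℝ) * (n - m) : ℝ) with hx
    set ε : ℂ := ((b * (n - 2 * m) : ℝ) : ℂ) - I * ((b ^ 2 : ℝ) : ℂ) with hε
    have hF : I * (I * (m : ℝ) - b) * (I * (n : ℝ) - (I * (m : ℝ) - b)) = x + ε := by
      rw [hx, hε]
      push_cast
      linear_combination (2 * (m : ℂ) * b - b * n + I * (n * m - m ^ 2)) * Complex.I_sq
    have hxn : ‖x‖ ≤ (n : ℝ) ^ 2 := by
      rw [hx, norm_mul, norm_neg, Complex.norm_I, one_mul, Complex.norm_real, Real.norm_eq_abs,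
        abs_of_nonneg (mul_nonneg hm0 (by linarith))]
      nlinarith
    have hεn : ‖ε‖ ≤ E * n := by
      refine (norm_sub_le _ _).trans ?_
      rw [norm_mul, Complex.norm_I, one_mul, Complex.norm_real, Complex.norm_real,
        Real.norm_eq_abs, Real.norm_eq_abs, abs_mul, abs_of_nonneg hb0,
        abs_of_nonneg (sq_nonneg (b : ℝ))]
      have : |(n : ℝ) - 2 * m| ≤ n := abs_le.2 ⟨by linarith, by linarith⟩
      rw [hE]
      nlinarith [mul_le_mul_of_nonneg_left this hb0, sq_nonneg (b : ℝ)]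
    have hE0 : 0 ≤ E := by positivity
    have hFn : ‖x + ε‖ ≤ (1 + E) * (n : ℝ) ^ 2 := by
      refine (norm_add_le _ _).trans ?_
      nlinarith [mul_le_mul_of_nonneg_left hn1 (mul_nonneg hE0 (by linarith : (0 : ℝ) ≤ n))]
    have hxb : ‖x ^ b‖ ≤ (n : ℝ) ^ (2 * b) := by
      rw [norm_pow, pow_mul]
      exact pow_le_pow_left₀ (norm_nonneg _) hxn b
    have hs : P * (x + ε) - x ^ (b + 1) = (P - x ^ b) * (x + ε) + x ^ b * ε := by ring
    rw [hF, hs]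
    calc ‖(P - x ^ b) * (x + ε) + x ^ b * ε‖ * n
        ≤ (‖P - x ^ b‖ * n) * ‖x + ε‖ + ‖x ^ b‖ * (‖ε‖ * n) := by
          have := norm_add_le ((P - x ^ b) * (x + ε)) (x ^ b * ε)
          rw [norm_mul, norm_mul] at this
          nlinarith
      _ ≤ (K * (n : ℝ) ^ (2 * b)) * ((1 + E) * (n : ℝ) ^ 2) + (n : ℝ) ^ (2 * b) * (E * n * n) := by
          refine add_le_add (mul_le_mul (hK n m hn hm) hFn (norm_nonneg _) (by positivity)) ?_
          exact mul_le_mul hxb (by gcongr) (by positivity) (by positivity)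
      _ = (K * (1 + E) + E) * (n : ℝ) ^ (2 * (b + 1)) := by ring

theorem le_norm_sum_mul_powFn (b N : ℕ) (hN : 1 ≤ N) {ξ : ℝ}
    (hξ : |Real.log ξ| * (4 * N) ≤ 1) :
    (N : ℝ) ^ (2 * b + 1) ≤ ‖∑ m ∈ range (4 * N),
      (-I * ((m : ℝ) * ((4 * N : ℕ) - m) : ℝ)) ^ b * powFn (I * (m : ℝ)) ξ‖ := by
  have hN0 : (0 : ℝ) ≤ N := Nat.cast_nonneg N
  have hre : ∀ m : ℕ, (powFn (I * (m : ℝ)) ξ).re = Real.cos (m * Real.log ξ) := by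
    intro m
    have : I * ((m : ℝ) : ℂ) * (Real.log ξ : ℂ) = ((m * Real.log ξ : ℝ) : ℂ) * I := by
      push_cast; ring
    rw [powFn, this, Complex.exp_ofReal_mul_I_re]
  have hcos : ∀ m ∈ range (4 * N), 1 / 2 ≤ Real.cos (m * Real.log ξ) := by
    intro m hm
    have hm' : (m : ℝ) ≤ 4 * N := by exact_mod_cast (mem_range.1 hm).le
    have h1 : |m * Real.log ξ| ≤ 1 := by
      rw [abs_mul, Nat.abs_cast]
      nlinarith [abs_nonneg (Real.log ξ)]
    have h2 := Real.one_sub_sq_div_two_le_cos (x := m * Real.log ξ)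
    have h3 := (sq_le_one_iff_abs_le_one _).2 h1
    linarith
  have hnn : ∀ m ∈ range (4 * N), (0 : ℝ) ≤ (m : ℝ) * ((4 * N : ℕ) - m) := by
    intro m hm
    have hm' : (m : ℝ) ≤ (4 * N : ℕ) := by exact_mod_cast (mem_range.1 hm).le
    exact mul_nonneg (Nat.cast_nonneg _) (by linarith)
  have hfac : ∑ m ∈ range (4 * N), (-I * ((m : ℝ) * ((4 * N : ℕ) - m) : ℝ)) ^ b *
      powFn (I * (m : ℝ)) ξ = (-I) ^ b * ∑ m ∈ range (4 * N),
        ((((m : ℝ) * ((4 * N : ℕ) - m)) ^ b : ℝ) : ℂ) * powFn (I * (m : ℝ)) ξ := by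
    rw [mul_sum]
    refine sum_congr rfl fun m _ => ?_
    rw [mul_pow, Complex.ofReal_pow, mul_assoc]
  rw [hfac, norm_mul, norm_pow, norm_neg, Complex.norm_I, one_pow, one_mul]
  refine le_trans ?_ (Complex.re_le_norm _)
  rw [Complex.re_sum]
  simp only [Complex.re_ofReal_mul, hre]
  have hsub : Ico N (3 * N) ⊆ range (4 * N) := by
    intro m hm
    rw [Finset.mem_Ico] at hm
    exact mem_range.2 (by omega)
  calc (N : ℝ) ^ (2 * b + 1) = ∑ m ∈ Ico N (3 * N), ((N : ℝ) ^ 2) ^ b * (1 / 2) := by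
        rw [sum_const, Nat.card_Ico, nsmul_eq_mul]
        have : 3 * N - N = 2 * N := by omega
        rw [this, pow_succ, pow_mul]
        push_cast
        ring
    _ ≤ ∑ m ∈ Ico N (3 * N), ((m : ℝ) * ((4 * N : ℕ) - m)) ^ b * Real.cos (m * Real.log ξ) := by
        refine sum_le_sum fun m hm => ?_
        have h1 := hcos m (hsub hm)
        rw [Finset.mem_Ico] at hm
        have h2 : (N : ℝ) ≤ m := by exact_mod_cast hm.1
        have h3 : (m : ℝ) ≤ 3 * N := by exact_mod_cast hm.2.le
        have h4 : (N : ℝ) ^ 2 ≤ (m : ℝ) * ((4 * N : ℕ) - m) := by push_cast; nlinarith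
        exact mul_le_mul (pow_le_pow_left₀ (by positivity) h4 b) h1 (by norm_num)
          (pow_nonneg ((by positivity : (0 : ℝ) ≤ (N : ℝ) ^ 2).trans h4) b)
    _ ≤ _ := by
        refine sum_le_sum_of_subset_of_nonneg hsub fun m hm _ => ?_
        exact mul_nonneg (pow_nonneg (hnn m hm) b) (by linarith [hcos m hm])

theorem exists_le_norm_hatU_iterate {f : ℕ → ℝ → ℂ} {S : Set ℝ} (hS : IsOpen S)
    (hpos : S ⊆ Set.Ioi 0)
    (hf : ∀ n, Set.EqOn (f n) (fun ξ => ∑ m ∈ range n, powFn (I * (m : ℝ)) ξ) S) (b : ℕ) :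
    ∃ K : ℝ, ∀ N : ℕ, 1 ≤ N → ∀ ξ ∈ S, ξ ≤ 1 → |Real.log ξ| * (4 * N) ≤ 1 →
      (N : ℝ) ^ (2 * b) * (N - K) ≤ ‖(hatU (I * ((4 * N : ℕ) : ℝ)))^[b] (f (4 * N)) ξ‖ := by
  obtain ⟨K, hK0, hK⟩ := exists_prod_sub_pow_le b
  refine ⟨K * 4 ^ (2 * b), fun N hN ξ hξ hξ1 hlog => ?_⟩
  have hξ0 : 0 < ξ := hpos hξ
  rw [hatU_iterate_sum_powFn hS hpos _ _ _ (hf (4 * N)) b hξ]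
  set A : ℕ → ℂ := fun m => ∏ j ∈ range b,
    (I * (I * (m : ℝ) - j) * (I * ((4 * N : ℕ) : ℝ) - (I * (m : ℝ) - j)))
  set B : ℕ → ℂ := fun m => (-I * ((m : ℝ) * ((4 * N : ℕ) - m) : ℝ)) ^ b
  have hsum : ∑ m ∈ range (4 * N), A m * powFn (I * (m : ℝ) - b) ξ =
      (∑ m ∈ range (4 * N), A m * powFn (I * (m : ℝ)) ξ) * ((ξ : ℂ) ^ b)⁻¹ := by
    simp only [powFn_sub_natCast _ hξ0, ← mul_assoc, sum_mul]
  change _ ≤ ‖∑ m ∈ range (4 * N), A m * powFn (I * (m : ℝ) - b) ξ‖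
  rw [hsum, norm_mul]
  have hinv : 1 ≤ ‖((ξ : ℂ) ^ b)⁻¹‖ := by
    rw [norm_inv, norm_pow, Complex.norm_real, Real.norm_eq_abs, abs_of_pos hξ0]
    exact (one_le_inv₀ (by positivity)).2 (pow_le_one₀ hξ0.le hξ1)
  refine le_trans ?_ (le_mul_of_one_le_right (norm_nonneg _) hinv)
  have hmain := le_norm_sum_mul_powFn b N hN hlog
  have herr : ‖∑ m ∈ range (4 * N), (B m - A m) * powFn (I * (m : ℝ)) ξ‖ ≤
      K * ((4 * N : ℕ) : ℝ) ^ (2 * b) := by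
    have hn0 : (0 : ℝ) < (4 * N : ℕ) := by exact_mod_cast (by omega : 0 < 4 * N)
    have h1 : ∀ m ∈ range (4 * N), ‖(B m - A m) * powFn (I * (m : ℝ)) ξ‖ ≤
        K * ((4 * N : ℕ) : ℝ) ^ (2 * b) / (4 * N : ℕ) := by
      intro m hm
      rw [norm_mul, norm_powFn_I, mul_one, norm_sub_rev, le_div_iff₀ hn0]
      exact hK (4 * N) m (by omega) (mem_range.1 hm).le
    refine (norm_sum_le_of_le _ h1).trans (le_of_eq ?_)
    rw [sum_const, card_range, nsmul_eq_mul]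
    field_simp
  have htri : ‖∑ m ∈ range (4 * N), B m * powFn (I * (m : ℝ)) ξ‖ ≤
      ‖∑ m ∈ range (4 * N), A m * powFn (I * (m : ℝ)) ξ‖ +
        ‖∑ m ∈ range (4 * N), (B m - A m) * powFn (I * (m : ℝ)) ξ‖ := by
    refine le_trans (le_of_eq ?_) (norm_add_le _ _)
    rw [← sum_add_distrib]
    congr 1
    exact sum_congr rfl fun m _ => by ring
  have hgoal : (N : ℝ) ^ (2 * b) * (N - K * 4 ^ (2 * b)) =
      (N : ℝ) ^ (2 * b + 1) - K * ((4 * N : ℕ) : ℝ) ^ (2 * b) := by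
    push_cast
    rw [mul_pow]
    ring
  rw [hgoal]
  linarith

theorem le_L2_of_le_norm {h : ℝ → ℂ} {M s t : ℝ} (hM : 0 ≤ M) (hst : s ≤ t)
    (hh : ∀ ξ ∈ Set.Icc s t, M ≤ ‖h ξ‖) :
    ENNReal.ofReal (M * √(t - s)) ≤ L2 h Set.univ := by
  have hI : ENNReal.ofReal (M ^ 2 * (t - s)) ≤ ∫⁻ ξ in Set.univ, ENNReal.ofReal (‖h ξ‖ ^ 2) := by
    rw [Measure.restrict_univ, ENNReal.ofReal_mul (by positivity), ← Real.volume_Icc,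
      ← setLIntegral_const]
    refine le_trans ?_ (setLIntegral_le_lintegral (Set.Icc s t) _)
    refine setLIntegral_mono' measurableSet_Icc fun ξ hξ => ?_
    exact ENNReal.ofReal_le_ofReal (pow_le_pow_left₀ hM (hh ξ hξ) 2)
  refine le_trans (le_of_eq ?_) (ENNReal.rpow_le_rpow hI (by norm_num))
  have : 0 ≤ t - s := sub_nonneg.2 hst
  rw [ENNReal.ofReal_rpow_of_nonneg (by positivity) (by norm_num), ← Real.sqrt_eq_rpow,
    Real.sqrt_mul (by positivity), Real.sqrt_sq hM]

theorem powFn_one_right (μ : ℂ) : powFn μ 1 = 1 := by simp [powFn]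

theorem powFn_I_ne_one {ξ : ℝ} (hξ : ξ ∈ Set.Ioo (1 / 2 : ℝ) 2) (h1 : ξ ≠ 1) :
    powFn I ξ ≠ 1 := by
  intro h
  have h0 : 0 < ξ := by linarith [hξ.1]
  have him : Real.sin (Real.log ξ) = 0 := by
    have := congrArg Complex.im h
    rw [powFn, mul_comm, Complex.exp_ofReal_mul_I_im] at this
    simpa using this
  have hlog : Real.log ξ ≠ 0 := by
    refine Real.log_ne_zero_of_pos_of_ne_one h0 h1
  have hu : Real.log ξ ≤ ξ - 1 := Real.log_le_sub_one_of_pos h0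
  have hl : 1 - ξ⁻¹ ≤ Real.log ξ := Real.one_sub_inv_le_log_of_pos h0
  have hinv : ξ⁻¹ < 2 := by
    rw [inv_lt_comm₀ h0 (by norm_num)]
    linarith [hξ.1]
  refine hlog ((Real.sin_eq_zero_iff_of_lt_of_lt ?_ ?_).1 him)
  · linarith [Real.pi_gt_three]
  · linarith [Real.pi_gt_three, hξ.2]

theorem contDiffAt_dslope_powFn {ξ : ℝ} (hξ : 0 < ξ) (μ : ℂ) :
    ContDiffAt ℝ (⊤ : ℕ∞) (dslope (powFn μ) 1) ξ := by
  rcases eq_or_ne ξ 1 with rfl | h1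
  · have ha : AnalyticAt ℝ (powFn μ) 1 :=
      (contDiffAt_powFn μ one_ne_zero).analyticAt
    obtain ⟨p, hp⟩ := ha
    exact AnalyticAt.contDiffAt ⟨_, hp.has_fpower_series_dslope_fslope⟩
  · have h2 : dslope (powFn μ) 1 =ᶠ[𝓝 ξ] fun x => ((x : ℂ) - 1)⁻¹ * (powFn μ x - powFn μ 1) := by
      filter_upwards [isOpen_ne.mem_nhds h1] with x hx
      rw [dslope_of_ne _ hx, slope_def_module, Complex.real_smul]
      push_cast
      rfl
    refine ContDiffAt.congr_of_eventuallyEq ?_ h2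
    refine ContDiffAt.mul ?_ ((contDiffAt_powFn μ hξ.ne').sub contDiffAt_const)
    refine (Complex.ofRealCLM.contDiff.contDiffAt.sub contDiffAt_const).inv ?_
    have : (ξ : ℂ) ≠ 1 := by exact_mod_cast h1
    simpa [sub_eq_zero] using this

theorem dslope_powFn_I_ne_zero {ξ : ℝ} (hξ : ξ ∈ Set.Ioo (1 / 2 : ℝ) 2) :
    dslope (powFn I) 1 ξ ≠ 0 := by
  rcases eq_or_ne ξ 1 with rfl | h1
  · rw [dslope_same, (hasDerivAt_powFn I one_pos).deriv, powFn_one_right]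
    simp
  · rw [dslope_of_ne _ h1, slope_def_module, powFn_one_right]
    exact smul_ne_zero (inv_ne_zero (sub_ne_zero.2 h1)) (sub_ne_zero.2 (powFn_I_ne_one hξ h1))

theorem powFn_I_natCast (m : ℕ) (ξ : ℝ) : powFn (I * (m : ℝ)) ξ = powFn I ξ ^ m := by
  rw [powFn, powFn, ← Complex.exp_nat_mul]
  congr 1
  push_cast
  ring

theorem isCutoff_mul_sum_powFn {χ : ℝ → ℂ} (hχ : IsCutoff χ) (n : ℕ) :
    IsCutoff (fun ξ => (∑ m ∈ range n, powFn (I * (m : ℝ)) ξ) * χ ξ) :=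
  hχ.mul fun ξ hξ => ContDiffAt.sum fun m _ => contDiffAt_powFn _ (by linarith [hξ.1])

theorem isOscillatory_mul_sum_powFn {χ : ℝ → ℂ} (hχ : IsCutoff χ) :
    IsOscillatory 0 (fun n ξ => I * ((ξ : ℂ) - 1) *
      ((∑ m ∈ range n, powFn (I * (m : ℝ)) ξ) * χ ξ)) := by
  have hq : IsCutoff (fun ξ => I * (dslope (powFn I) 1 ξ)⁻¹ * χ ξ) :=
    hχ.mul fun ξ hξ => contDiffAt_const.mul
      ((contDiffAt_dslope_powFn (by linarith [hξ.1]) I).inv (dslope_powFn_I_ne_zero hξ))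
  refine ⟨_, _, .const hq, (IsSymbol.const hq).const_mul (-1), fun n => ?_⟩
  ext ξ
  by_cases hξ : χ ξ = 0
  · simp [hξ]
  · have hI := hχ.2 hξ
    have hd : dslope (powFn I) 1 ξ ≠ 0 :=
      dslope_powFn_I_ne_zero ⟨by linarith [hI.1], by linarith [hI.2]⟩
    have hs : ((ξ : ℂ) - 1) * dslope (powFn I) 1 ξ = powFn I ξ - 1 := by
      have := sub_smul_dslope (powFn I) 1 ξ
      rw [Complex.real_smul, powFn_one_right] at this
      exact_mod_cast this
    have hg := mul_neg_geom_sum (powFn I ξ) n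
    simp only [powFn_I_natCast]
    field_simp
    linear_combination (∑ i ∈ range n, powFn I ξ ^ i) * hs - hg

theorem exists_isCutoff_eqOn_one : ∃ χ : ℝ → ℂ, IsCutoff χ ∧
    Set.EqOn χ (fun _ => 1) (Set.Ioo (7 / 8 : ℝ) (9 / 8)) := by
  let χ : ContDiffBump (1 : ℝ) := ⟨1 / 8, 1 / 4, by norm_num, by norm_num⟩
  refine ⟨fun ξ => (χ ξ : ℂ), ⟨Complex.ofRealCLM.contDiff.comp χ.contDiff, fun ξ hξ => ?_⟩,
    fun ξ hξ => ?_⟩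
  · have h1 : ξ ∈ Function.support χ := fun h => hξ (by simp [h])
    rw [χ.support_eq, Real.ball_eq_Ioo] at h1
    simp only [χ, Set.mem_Ioo] at h1
    exact ⟨by linarith [h1.1], by linarith [h1.2]⟩
  · have h1 : ξ ∈ Metric.closedBall (1 : ℝ) χ.rIn := by
      rw [Real.closedBall_eq_Icc]
      simp only [χ]
      exact ⟨by linarith [hξ.1], by linarith [hξ.2]⟩
    simp [χ.one_of_mem_closedBall h1]

/-- No tame estimate losing `σ ≤ β` derivatives for the twisted cohomological equation:
for every `C > 0` there are `a ≠ 0` (`ν = ia`) and smooth `f, g` supported in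
`[3/4, 4/3]` with `(ξ−1)·f = −i·g` and
`‖Û^β f‖_{L²(ℝ)} > C Σ_{j+k+l ≤ β+σ} ‖V̂^j X̂^k Û^l g‖_{L²(ℝ)}`. -/
theorem no_tame_estimate_twisted (β σ : ℕ) (hσ : σ ≤ β) (C : ℝ) (hC : 0 < C) :
    ∃ a : ℝ, a ≠ 0 ∧ ∃ f g : ℝ → ℂ,
      ContDiff ℝ (⊤ : ℕ∞) f ∧ HasCompactSupport f ∧
        Function.support f ⊆ Set.Icc (3 / 4 : ℝ) (4 / 3) ∧
      ContDiff ℝ (⊤ : ℕ∞) g ∧ HasCompactSupport g ∧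
        Function.support g ⊆ Set.Icc (3 / 4 : ℝ) (4 / 3) ∧
      (∀ ξ : ℝ, ((ξ : ℂ) - 1) * f ξ = -Complex.I * g ξ) ∧
      ENNReal.ofReal C *
          (∑ j ∈ range (β + σ + 1), ∑ k ∈ range (β + σ + 1 - j),
            ∑ l ∈ range (β + σ + 1 - j - k),
              L2 (hatV^[j] ((hatX (Complex.I * a))^[k] ((hatU (Complex.I * a))^[l] g)))
                Set.univ) <
        L2 ((hatU (Complex.I * a))^[β] f) Set.univ := by
  obtain ⟨χ, hχ, hχ1⟩ := exists_isCutoff_eqOn_one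
  set f : ℕ → ℝ → ℂ := fun n ξ => (∑ m ∈ range n, powFn (I * (m : ℝ)) ξ) * χ ξ with hf
  set g : ℕ → ℝ → ℂ := fun n ξ => I * ((ξ : ℂ) - 1) * f n ξ with hg
  have hfc : ∀ n, IsCutoff (f n) := isCutoff_mul_sum_powFn hχ
  have hgc : ∀ n, IsCutoff (g n) := fun n => (hfc n).mul fun ξ _ =>
    contDiffAt_const.mul (Complex.ofRealCLM.contDiff.contDiffAt.sub contDiffAt_const)
  obtain ⟨K, hK0, hK⟩ := exists_sum_L2_le (isOscillatory_mul_sum_powFn hχ) (β + σ)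
  obtain ⟨L, hL⟩ := exists_le_norm_hatU_iterate (f := f)
    (S := Set.Ioo (7 / 8) (9 / 8)) isOpen_Ioo
    (fun ξ hξ => lt_trans (by norm_num) hξ.1)
    (fun n ξ hξ => by simp only [hf, hχ1 hξ, mul_one]) β
  obtain ⟨Q, hQ⟩ : ∃ Q, Q = C * K * 4 ^ (β + σ) := ⟨_, rfl⟩
  have hQ0 : 0 ≤ Q := by rw [hQ]; positivity
  obtain ⟨N, hN⟩ := exists_nat_gt (max (2 * |L|) (32 * Q ^ 2) + 1)
  have hN1 : (1 : ℝ) < N := by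
    have : 0 ≤ max (2 * |L|) (32 * Q ^ 2) := le_max_of_le_right (by positivity)
    linarith
  have hNL : 2 * |L| < N := by linarith [le_max_left (2 * |L|) (32 * Q ^ 2)]
  have hNQ : 32 * Q ^ 2 < N := by linarith [le_max_right (2 * |L|) (32 * Q ^ 2)]
  have hN1' : 1 ≤ N := by exact_mod_cast hN1.le
  have hN2 : (2 : ℝ) ≤ N := by exact_mod_cast (by exact_mod_cast hN1 : 1 < N)
  refine ⟨((4 * N : ℕ) : ℝ), by positivity, f (4 * N), g (4 * N), (hfc _).1,
    (hfc _).hasCompactSupport, (hfc _).2, (hgc _).1, (hgc _).hasCompactSupport, (hgc _).2,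
    fun ξ => ?_, ?_⟩
  · simp only [hg]
    linear_combination (((ξ : ℂ) - 1) * f (4 * N) ξ) * Complex.I_sq
  have hupper := hK (4 * N) (by omega)
  have hlower := le_L2_of_le_norm (h := (hatU (I * ((4 * N : ℕ) : ℝ)))^[β] (f (4 * N)))
    (M := (N : ℝ) ^ (2 * β) * (N / 2)) (s := 1 - 1 / (8 * N)) (t := 1) (by positivity)
    (sub_le_self _ (by positivity)) (fun ξ hξ => ?_)
  · refine lt_of_le_of_lt (mul_le_mul_right hupper _) (lt_of_lt_of_le ?_ hlower)
    rw [← ENNReal.ofReal_mul hC.le]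
    have hpow : (N : ℝ) ^ (β + σ) ≤ (N : ℝ) ^ (2 * β) :=
      pow_le_pow_right₀ hN1.le (by omega)
    have hsq : Q < N / 2 * √(1 - (1 - 1 / (8 * N))) := by
      refine lt_of_pow_lt_pow_left₀ 2 (by positivity) ?_
      have h8 : 1 - (1 - 1 / (8 * (N : ℝ))) = 1 / (8 * N) := by ring
      rw [h8, mul_pow, Real.sq_sqrt (by positivity)]
      have : (N / 2 : ℝ) ^ 2 * (1 / (8 * N)) = N / 32 := by field_simp; norm_num
      rw [this]
      linarith
    have hP : (0 : ℝ) < (N : ℝ) ^ (2 * β) := by positivity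
    have hle : C * (K * ((4 * N : ℕ) : ℝ) ^ (β + σ)) ≤ (N : ℝ) ^ (2 * β) * Q := by
      have : C * (K * ((4 * N : ℕ) : ℝ) ^ (β + σ)) = (N : ℝ) ^ (β + σ) * Q := by
        rw [hQ]; push_cast; rw [mul_pow]; ring
      rw [this]
      exact mul_le_mul_of_nonneg_right hpow hQ0
    rw [mul_assoc]
    have hlt := mul_lt_mul_of_pos_left hsq hP
    exact (ENNReal.ofReal_lt_ofReal_iff (lt_of_le_of_lt (by positivity) hlt)).2
      (hle.trans_lt hlt)
  · have hs : 1 / (8 * (N : ℝ)) ≤ 1 / 16 := by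
      apply one_div_le_one_div_of_le <;> linarith
    have hξ0 : 15 / 16 ≤ ξ := by linarith [hξ.1]
    refine le_trans ?_ (hL N hN1' ξ ⟨by linarith, by linarith [hξ.2]⟩ hξ.2 ?_)
    · gcongr
      linarith [le_abs_self L]
    · have hpos : 0 < ξ := by linarith
      have h1 : 1 - ξ⁻¹ ≤ Real.log ξ := Real.one_sub_inv_le_log_of_pos hpos
      have h2 : Real.log ξ ≤ 0 := Real.log_nonpos hpos.le hξ.2
      rw [abs_of_nonpos h2]
      have h3 : ξ⁻¹ - 1 ≤ 1 / (4 * N) := by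
        have : ξ⁻¹ - 1 = (1 - ξ) / ξ := by field_simp
        rw [this, div_le_div_iff₀ hpos (by positivity)]
        have h4 : (1 - ξ) * (8 * N) ≤ 1 := by
          rw [← le_div_iff₀ (by positivity)]
          linarith [hξ.1]
        nlinarith
      calc -Real.log ξ * (4 * N) ≤ 1 / (4 * N) * (4 * N) := by gcongr; linarith
        _ = 1 := by field_simp
end
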